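/- arXiv:0710.1816 — 2 statements merged into one kernel-verified Lean document; each statement's English description precedes it below -/
import Mathlib

section
/- For n ≥ 1 and partitions λ and π of [n], λ ∼_cr π if and only if cr(λ) = cr(π) and crset(λ) = crset(π) as multisets. -/
open Finset

/-- A set partition of `[n] = {1,…,n}`, modeled as a `Finpartition` of `Fin n`. -/
abbrev SetPartition (n : ℕ) := Finpartition (Finset.univ : Finset (Fin n))

/-- `(i,j)` is an arc of the partition `p`: `i < j`, they lie in a common block,
and no element of that block lies strictly between them. -/
def IsArc {n : ℕ} (p : SetPartition n) (i j : Fin n) : Prop :=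
  i < j ∧ ∃ B ∈ p.parts, i ∈ B ∧ j ∈ B ∧ ∀ x ∈ B, ¬ (i < x ∧ x < j)

/-- Arcs `a = (i₁,j₁)` and `b = (i₂,j₂)` form a crossing: `i₁ < i₂ < j₁ < j₂`. -/
def Crossing {n : ℕ} (a b : Fin n × Fin n) : Prop :=
  a.1 < b.1 ∧ b.1 < a.2 ∧ a.2 < b.2

/-- Arcs `a = (i₁,j₁)` and `b = (i₂,j₂)` form a nesting: `i₁ < i₂ < j₂ < j₁`. -/
def Nesting {n : ℕ} (a b : Fin n × Fin n) : Prop :=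
  a.1 < b.1 ∧ b.1 < b.2 ∧ b.2 < a.2

/-- `cr p`: the number of crossings of two arcs in `p`. -/
noncomputable def cr {n : ℕ} (p : SetPartition n) : ℕ :=
  {e : (Fin n × Fin n) × (Fin n × Fin n) |
    IsArc p e.1.1 e.1.2 ∧ IsArc p e.2.1 e.2.2 ∧ Crossing e.1 e.2}.ncard

/-- `ne' p`: the number of nestings of two arcs in `p`. -/
noncomputable def ne' {n : ℕ} (p : SetPartition n) : ℕ :=
  {e : (Fin n × Fin n) × (Fin n × Fin n) |
    IsArc p e.1.1 e.1.2 ∧ IsArc p e.2.1 e.2.2 ∧ Nesting e.1 e.2}.ncard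

/-- `al p`: the number of alignments (unordered pairs of arcs that neither
cross nor nest, counted with first endpoints in increasing order). -/
noncomputable def al {n : ℕ} (p : SetPartition n) : ℕ :=
  {e : (Fin n × Fin n) × (Fin n × Fin n) |
    IsArc p e.1.1 e.1.2 ∧ IsArc p e.2.1 e.2.2 ∧ e.1.1 < e.2.1 ∧
    ¬ Crossing e.1 e.2 ∧ ¬ Crossing e.2 e.1 ∧
    ¬ Nesting e.1 e.2 ∧ ¬ Nesting e.2 e.1}.ncard

/-- `i` and `j` lie in a common block of `p`. -/
def InSameBlock {n : ℕ} (p : SetPartition n) (i j : Fin n) : Prop :=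
  ∃ B ∈ p.parts, i ∈ B ∧ j ∈ B

/-- `c` (a partition of `[n+1]`) is a child of `p` (a partition of `[n]`):
deleting the element `1` from `c` and shifting down by one yields `p`. -/
def IsChild {n : ℕ} (c : SetPartition (n + 1)) (p : SetPartition n) : Prop :=
  ∀ i j : Fin n, (InSameBlock p i j ↔ InSameBlock c i.succ j.succ)

/-- `level p l` is `T(p, l)`: the set of partitions of `[n+l]` at the `l`-th level of
the subtree rooted at `p` in the tree of partitions. -/
def level {n : ℕ} (p : SetPartition n) : (l : ℕ) → Set (SetPartition (n + l))
  | 0 => {p}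
  | l + 1 => {c | ∃ q ∈ level p l, IsChild c q}

/-- The statistic `s_{α,β}(p) = cr(p)·α + ne(p)·β`. -/
noncomputable def statS {G : Type*} [AddCommGroup G] (α β : G) {n : ℕ} (p : SetPartition n) : G :=
  cr p • α + ne' p • β

/-- The minimum of a block, as a natural number (`0` for the empty set). -/
noncomputable def minOfBlock {n : ℕ} (B : Finset (Fin n)) : ℕ :=
  sInf (Fin.val '' (B : Set (Fin n)))

/-- `u(p, b)`: the number of arcs `(x, y)` of `p` with `x < b < y` (values in `ℕ`). -/
noncomputable def uStat {n : ℕ} (p : SetPartition n) (b : ℕ) : ℕ :=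
  {e : Fin n × Fin n | IsArc p e.1 e.2 ∧ (e.1 : ℕ) < b ∧ b < (e.2 : ℕ)}.ncard

/-- `v(p, b)`: the number of arcs `(x, y)` of `p` with `x < y < b` (values in `ℕ`). -/
noncomputable def vStat {n : ℕ} (p : SetPartition n) (b : ℕ) : ℕ :=
  {e : Fin n × Fin n | IsArc p e.1 e.2 ∧ (e.2 : ℕ) < b}.ncard

/-- `crset p`: the multiset `{u₁(p), …, u_k(p)}`, where `u_i(p)` is the number of arcs
passing over the minimum `b_i` of the `i`-th block. -/
noncomputable def crset {n : ℕ} (p : SetPartition n) : Multiset ℕ :=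
  p.parts.val.map fun B => uStat p (minOfBlock B)

/-- `neseq p`: the sequence `(v₁(p), …, v_k(p))`, where `v_i(p)` is the number of arcs
lying entirely to the left of the minimum `b_i` of the `i`-th block, blocks being ordered
by increasing minima. -/
noncomputable def neseq {n : ℕ} (p : SetPartition n) : List ℕ :=
  ((p.parts.image fun B => minOfBlock B).sort (· ≤ ·)).map fun b => vStat p b

/-- `p ∼_cr q`: the statistic `cr` has the same distribution on `T(p,l,m)` and `T(q,l,m)`
for all `l, m ≥ 0` (multiset equality expressed by counting, for each value `c`, the
partitions attaining it). -/
def SimCr {n : ℕ} (p q : SetPartition n) : Prop :=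
  ∀ l m c : ℕ,
    {t ∈ level p l | t.parts.card = m ∧ cr t = c}.ncard =
    {t ∈ level q l | t.parts.card = m ∧ cr t = c}.ncard

/-- `p ∼_ne q`: the statistic `ne` has the same distribution on `T(p,l,m)` and `T(q,l,m)`
for all `l, m ≥ 0`. -/
def SimNe {n : ℕ} (p q : SetPartition n) : Prop :=
  ∀ l m c : ℕ,
    {t ∈ level p l | t.parts.card = m ∧ ne' t = c}.ncard =
    {t ∈ level q l | t.parts.card = m ∧ ne' t = c}.ncard

/-- `∼_cr` as a setoid on `Π_{n,k}`, the partitions of `[n]` with exactly `k` blocks. -/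
def crSetoid (n k : ℕ) : Setoid {p : SetPartition n // p.parts.card = k} :=
  ⟨fun p q => SimCr p.1 q.1,
    ⟨fun _ _ _ _ => rfl, fun h l m c => (h l m c).symm,
      fun h₁ h₂ l m c => (h₁ l m c).trans (h₂ l m c)⟩⟩

/-- `∼_ne` as a setoid on `Π_{n,k}`, the partitions of `[n]` with exactly `k` blocks. -/
def neSetoid (n k : ℕ) : Setoid {p : SetPartition n // p.parts.card = k} :=
  ⟨fun p q => SimNe p.1 q.1,
    ⟨fun _ _ _ _ => rfl, fun h l m c => (h l m c).symm,
      fun h₁ h₂ l m c => (h₁ l m c).trans (h₂ l m c)⟩⟩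

/-- `∼_ne` as a setoid on all of `Π_n`. -/
def neSetoidAll (n : ℕ) : Setoid (SetPartition n) :=
  ⟨SimNe,
    ⟨fun _ _ _ _ => rfl, fun h l m c => (h l m c).symm,
      fun h₁ h₂ l m c => (h₁ l m c).trans (h₂ l m c)⟩⟩

namespace SetPartition

variable {n : ℕ}

theorem inSameBlock_iff (p : SetPartition n) (i j : Fin n) :
    InSameBlock p i j ↔ p.part i = p.part j := by
  rw [← p.mem_part_iff_part_eq_part (mem_univ i) (mem_univ j), Finpartition.mem_part_iff_exists]
  rfl

theorem mem_part_iff (p : SetPartition n) (i j : Fin n) :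
    i ∈ p.part j ↔ p.part i = p.part j :=
  p.mem_part_iff_part_eq_part (mem_univ i) (mem_univ j)

theorem isArc_iff (p : SetPartition n) (i j : Fin n) :
    IsArc p i j ↔ i < j ∧ p.part i = p.part j ∧
      ∀ x, p.part x = p.part j → ¬ (i < x ∧ x < j) := by
  refine and_congr_right fun _ => ⟨?_, ?_⟩
  · rintro ⟨B, hB, hi, hj, h⟩
    have hi' := p.part_eq_of_mem hB hi
    have hj' := p.part_eq_of_mem hB hj
    exact ⟨hi'.trans hj'.symm, fun x hx => h x ((p.part_eq_iff_mem hB).1 (hx.trans hj'))⟩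
  · rintro ⟨hij, h⟩
    exact ⟨p.part j, p.part_mem.2 (mem_univ _), (p.mem_part_iff i j).2 hij,
      p.mem_part (mem_univ _), fun x hx => h x ((p.mem_part_iff x j).1 hx)⟩

theorem ext_part {p q : SetPartition n}
    (h : ∀ i j, p.part i = p.part j ↔ q.part i = q.part j) : p = q := by
  have hpart : ∀ i, p.part i = q.part i := fun i => by
    ext j
    rw [mem_part_iff, mem_part_iff, h]
  ext B
  constructor <;> intro hB
  · obtain ⟨x, -, rfl⟩ := p.part_surjOn hB
    rw [hpart]
    exact q.part_mem.2 (mem_univ _)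
  · obtain ⟨x, -, rfl⟩ := q.part_surjOn hB
    rw [← hpart]
    exact p.part_mem.2 (mem_univ _)

/-- The minima of the blocks of `p`. -/
def openers (p : SetPartition n) : Finset (Fin n) :=
  {b | ∀ x, p.part x = p.part b → b ≤ x}

theorem mem_openers {p : SetPartition n} {b : Fin n} :
    b ∈ p.openers ↔ ∀ x, p.part x = p.part b → b ≤ x := by
  simp [openers]

theorem exists_opener (p : SetPartition n) (i : Fin n) :
    ∃ b ∈ p.openers, p.part b = p.part i := by
  have hne : (p.part i).Nonempty := ⟨i, p.mem_part (mem_univ i)⟩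
  have hb := (p.mem_part_iff _ i).1 ((p.part i).min'_mem hne)
  exact ⟨_, mem_openers.2 fun x hx =>
    (p.part i).min'_le x ((p.mem_part_iff x i).2 (hx.trans hb)), hb⟩

theorem injOn_part_openers (p : SetPartition n) : Set.InjOn p.part p.openers :=
  fun _ ha _ hb h => le_antisymm (mem_openers.1 ha _ h.symm) (mem_openers.1 hb _ h)

theorem image_part_openers (p : SetPartition n) : p.openers.image p.part = p.parts := by
  ext B
  rw [mem_image]
  constructor
  · rintro ⟨b, -, rfl⟩
    exact p.part_mem.2 (mem_univ _)
  · intro hB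
    obtain ⟨x, -, rfl⟩ := p.part_surjOn hB
    exact p.exists_opener x

theorem card_openers (p : SetPartition n) : #p.openers = #p.parts := by
  rw [← image_part_openers, card_image_of_injOn p.injOn_part_openers]

theorem minOfBlock_part {p : SetPartition n} {b : Fin n} (hb : b ∈ p.openers) :
    minOfBlock (p.part b) = b := by
  refine IsLeast.csInf_eq ⟨⟨b, p.mem_part (mem_univ b), rfl⟩, ?_⟩
  rintro _ ⟨x, hx, rfl⟩
  exact mem_openers.1 hb x ((p.mem_part_iff x b).1 hx)

theorem crset_eq (p : SetPartition n) :
    crset p = p.openers.val.map fun b : Fin n => uStat p (b : ℕ) := by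
  rw [crset, ← image_part_openers, image_val_of_injOn p.injOn_part_openers, Multiset.map_map]
  exact Multiset.map_congr rfl fun b hb => by
    rw [Function.comp_apply, minOfBlock_part (mem_def.2 hb)]

open Classical in
/-- The child of `p` whose new least element forms a singleton block (for `none`) or joins the
block of `b` (for `some b`). -/
noncomputable def child (p : SetPartition n) (o : Option (Fin n)) : SetPartition (n + 1) :=
  Finpartition.ofSetoid (Setoid.ker
    (Fin.cons (o.map p.part) (fun i => some (p.part i)) : Fin (n + 1) → Option (Finset (Fin n))))

theorem part_child_eq_iff (p : SetPartition n) (o : Option (Fin n)) (i j : Fin (n + 1)) :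
    (p.child o).part i = (p.child o).part j ↔
      (Fin.cons (o.map p.part) (fun i => some (p.part i)) : Fin (n + 1) → Option (Finset (Fin n))) i
       = (Fin.cons (o.map p.part) (fun i => some (p.part i)) :
          Fin (n + 1) → Option (Finset (Fin n))) j := by
  classical
  rw [eq_comm, ← mem_part_iff, child, Finpartition.mem_part_ofSetoid_iff_rel]
  rfl

@[simp]
theorem part_child_succ_eq_succ (p : SetPartition n) (o : Option (Fin n)) (i j : Fin n) :
    (p.child o).part i.succ = (p.child o).part j.succ ↔ p.part i = p.part j := by
  simp [part_child_eq_iff]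

@[simp]
theorem part_child_zero_eq_succ (p : SetPartition n) (o : Option (Fin n)) (j : Fin n) :
    (p.child o).part 0 = (p.child o).part j.succ ↔ o.map p.part = some (p.part j) := by
  simp [part_child_eq_iff]

@[simp]
theorem part_child_succ_eq_zero (p : SetPartition n) (o : Option (Fin n)) (j : Fin n) :
    (p.child o).part j.succ = (p.child o).part 0 ↔ o.map p.part = some (p.part j) := by
  rw [eq_comm, part_child_zero_eq_succ]

theorem isChild_iff {c : SetPartition (n + 1)} {p : SetPartition n} :
    IsChild c p ↔ ∃ o ∈ insertNone p.openers, c = p.child o := by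
  simp only [IsChild, inSameBlock_iff]
  constructor
  · intro h
    by_cases h0 : ∃ j : Fin n, c.part 0 = c.part j.succ
    · obtain ⟨j, hj⟩ := h0
      obtain ⟨b, hb, hbj⟩ := p.exists_opener j
      refine ⟨some b, by simpa using hb, ext_part fun x y => ?_⟩
      have key : ∀ y : Fin n, c.part 0 = c.part y.succ ↔ p.part b = p.part y := fun y => by
        rw [hj, ← h, hbj]
      cases x using Fin.cases <;> cases y using Fin.cases <;>
        simp [key, h, eq_comm (b := c.part 0)]
    · push Not at h0
      refine ⟨none, by simp, ext_part fun x y => ?_⟩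
      cases x using Fin.cases <;> cases y using Fin.cases <;>
        simp [h0, h, eq_comm (b := c.part 0)]
  · rintro ⟨o, -, rfl⟩ i j
    simp

theorem child_injOn (p : SetPartition n) :
    Set.InjOn p.child (insertNone p.openers : Finset (Option (Fin n))) := by
  intro o ho o' ho' h
  have key : ∀ j, o.map p.part = some (p.part j) ↔ o'.map p.part = some (p.part j) := fun j => by
    rw [← part_child_zero_eq_succ, h, part_child_zero_eq_succ]
  rcases o with _ | b <;> rcases o' with _ | b'
  · rfl
  · simpa using key b'
  · simpa using key b
  · have := (key b).1 rfl
    simp only [Option.map_some, Option.some_inj] at this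
    rw [p.injOn_part_openers (by simpa using ho') (by simpa using ho) this]

theorem eq_of_child_eq {p q : SetPartition n} {o o' : Option (Fin n)}
    (h : p.child o = q.child o') : p = q :=
  ext_part fun i j => by
    rw [← part_child_succ_eq_succ p o, h, part_child_succ_eq_succ]

@[simp]
theorem isArc_child_succ_succ (p : SetPartition n) (o : Option (Fin n)) (i j : Fin n) :
    IsArc (p.child o) i.succ j.succ ↔ IsArc p i j := by
  simp [isArc_iff, Fin.forall_fin_succ]

@[simp]
theorem not_isArc_zero (p : SetPartition (n + 1)) (i : Fin (n + 1)) : ¬ IsArc p i 0 :=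
  fun h => Fin.not_lt_zero i h.1

theorem isArc_child_zero_succ {p : SetPartition n} {o : Option (Fin n)}
    (ho : o ∈ insertNone p.openers) (j : Fin n) :
    IsArc (p.child o) 0 j.succ ↔ o = some j := by
  rcases o with _ | b
  · simp [isArc_iff]
  · have hb : b ∈ p.openers := by simpa using ho
    simp only [isArc_iff, Fin.succ_pos, part_child_zero_eq_succ, Option.map_some, Option.some_inj,
      true_and, Fin.forall_fin_succ, part_child_succ_eq_succ, Fin.succ_lt_succ_iff, lt_self_iff_false,
      false_and, not_false_eq_true, implies_true, not_lt]
    constructor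
    · rintro ⟨h, h'⟩
      exact le_antisymm (mem_openers.1 hb j h.symm) (h' b h)
    · rintro rfl
      exact ⟨rfl, mem_openers.1 hb⟩

theorem cr_child {p : SetPartition n} {o : Option (Fin n)} (ho : o ∈ insertNone p.openers) :
    cr (p.child o) = cr p +
      {e : Fin n × Fin n | IsArc p e.1 e.2 ∧ ∃ b ∈ o, e.1 < b ∧ b < e.2}.ncard := by
  have hinj : Function.Injective (Prod.map (Fin.succ (n := n)) (Fin.succ (n := n))) :=
    (Fin.succ_injective n).prodMap (Fin.succ_injective n)
  have key : {e : (Fin (n + 1) × Fin (n + 1)) × Fin (n + 1) × Fin (n + 1) |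
      IsArc (p.child o) e.1.1 e.1.2 ∧ IsArc (p.child o) e.2.1 e.2.2 ∧ Crossing e.1 e.2} =
      Prod.map (Prod.map Fin.succ Fin.succ) (Prod.map Fin.succ Fin.succ) ''
        {e | IsArc p e.1.1 e.1.2 ∧ IsArc p e.2.1 e.2.2 ∧ Crossing e.1 e.2} ∪
      (fun e => ((0, (o.map Fin.succ).getD 0), Prod.map Fin.succ Fin.succ e)) ''
        {e | IsArc p e.1 e.2 ∧ ∃ b ∈ o, e.1 < b ∧ b < e.2} := by
    ext ⟨⟨i, j⟩, k, l⟩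
    cases i using Fin.cases <;> cases j using Fin.cases <;> cases k using Fin.cases <;>
      cases l using Fin.cases <;> cases o <;>
      simp [Crossing, isArc_child_zero_succ ho, (Fin.succ_ne_zero _).symm] <;> grind
  rw [cr, key, Set.ncard_union_eq, Set.ncard_image_of_injective _ (hinj.prodMap hinj),
    Set.ncard_image_of_injective, cr]
  · exact fun e e' h => hinj (Prod.ext_iff.1 h).2
  · rw [Set.disjoint_left]
    rintro _ ⟨⟨⟨i, j⟩, k, l⟩, -, rfl⟩ ⟨⟨k', l'⟩, -, h⟩
    simp [Fin.succ_ne_zero, eq_comm] at h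

@[simp]
theorem cr_child_none (p : SetPartition n) : cr (p.child none) = cr p := by
  simp [cr_child (p := p) (o := none) (by simp)]

theorem cr_child_some {p : SetPartition n} {b : Fin n} (hb : b ∈ p.openers) :
    cr (p.child (some b)) = cr p + uStat p b := by
  simp [cr_child (p := p) (o := some b) (by simpa using hb), uStat]

@[simp]
theorem uStat_zero (p : SetPartition n) : uStat p 0 = 0 := by
  simp [uStat]

theorem uStat_child_succ {p : SetPartition n} {o : Option (Fin n)}
    (ho : o ∈ insertNone p.openers) (x : Fin n) :
    uStat (p.child o) x.succ = uStat p x + {b | b ∈ o ∧ x < b}.ncard := by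
  have key : {e : Fin (n + 1) × Fin (n + 1) | IsArc (p.child o) e.1 e.2 ∧
      (e.1 : ℕ) < x.succ ∧ (x.succ : ℕ) < e.2} =
      Prod.map Fin.succ Fin.succ '' {e : Fin n × Fin n | IsArc p e.1 e.2 ∧
        (e.1 : ℕ) < x ∧ (x : ℕ) < e.2} ∪ (fun b => (0, Fin.succ b)) '' {b | b ∈ o ∧ x < b} := by
    ext ⟨i, j⟩
    cases i using Fin.cases <;> cases j using Fin.cases <;>
      simp [isArc_child_zero_succ ho, (Fin.succ_ne_zero _).symm, and_comm]
  rw [uStat, key, Set.ncard_union_eq,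
    Set.ncard_image_of_injective _ ((Fin.succ_injective n).prodMap (Fin.succ_injective n)),
    Set.ncard_image_of_injective, uStat]
  · exact fun e e' h => Fin.succ_injective n (Prod.ext_iff.1 h).2
  · rw [Set.disjoint_left]
    rintro _ ⟨⟨i, j⟩, -, rfl⟩ ⟨b, -, h⟩
    simp [Fin.succ_ne_zero, eq_comm] at h

@[simp]
theorem uStat_child_none (p : SetPartition n) (x : Fin n) :
    uStat (p.child none) (x + 1 : ℕ) = uStat p x := by
  simpa using uStat_child_succ (p := p) (o := none) (by simp) x

theorem uStat_child_some {p : SetPartition n} {b : Fin n} (hb : b ∈ p.openers) (x : Fin n) :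
    uStat (p.child (some b)) (x + 1 : ℕ) = uStat p x + if x < b then 1 else 0 := by
  have := uStat_child_succ (p := p) (o := some b) (by simpa using hb) x
  rw [Fin.val_succ] at this
  rw [this]
  split_ifs with h
  · simp only [Option.mem_some_iff]
    rw [show {c | b = c ∧ x < c} = {b} by grind, Set.ncard_singleton]
  · simp only [Option.mem_some_iff]
    rw [show {c | b = c ∧ x < c} = ∅ by grind, Set.ncard_empty]

theorem openers_child {p : SetPartition n} {o : Option (Fin n)}
    (ho : o ∈ insertNone p.openers) :
    (p.child o).openers = cons 0 ({x ∈ p.openers | x ∉ o}.map (Fin.succEmb n))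
      (by simp [Fin.succ_ne_zero]) := by
  ext x
  cases x using Fin.cases with
  | zero => simp [mem_openers]
  | succ x =>
    rw [mem_openers, Fin.forall_fin_succ]
    simp only [part_child_zero_eq_succ, part_child_succ_eq_succ, Fin.succ_le_succ_iff, mem_cons,
      Fin.succ_ne_zero, false_or, mem_map, mem_filter, Fin.coe_succEmb, Fin.succ_inj,
      exists_eq_right, ← mem_openers, Fin.le_zero_iff]
    rw [and_comm, and_congr_right_iff]
    intro hx
    rcases o with _ | b
    · simp
    · have := p.injOn_part_openers.eq_iff (by simpa using ho : b ∈ p.openers) hx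
      simpa using not_congr this

theorem card_parts_child_none (p : SetPartition n) : #(p.child none).parts = #p.parts + 1 := by
  rw [← card_openers, openers_child (by simp), card_cons, card_map]
  simp [card_openers]

theorem card_parts_child_some {p : SetPartition n} {b : Fin n} (hb : b ∈ p.openers) :
    #(p.child (some b)).parts = #p.parts := by
  rw [← card_openers, openers_child (by simpa using hb), card_cons, card_map,
    show {x ∈ p.openers | x ∉ some b} = p.openers.erase b by ext; simp [and_comm, eq_comm],
    card_erase_add_one hb, card_openers]

open Classical in
/-- The set `level p l` as a finset. -/
noncomputable def levelFinset (p : SetPartition n) : (l : ℕ) → Finset (SetPartition (n + l))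
  | 0 => {p}
  | l + 1 => (p.levelFinset l).biUnion fun q => (insertNone q.openers).image q.child

theorem coe_levelFinset (p : SetPartition n) (l : ℕ) : (p.levelFinset l : Set _) = level p l := by
  induction l with
  | zero => simp [levelFinset, level]
  | succ l ih =>
    ext c
    simp only [levelFinset, level, ← ih, isChild_iff, coe_biUnion, coe_image, Set.mem_iUnion,
      Set.mem_image, mem_coe, Set.mem_ofPred_eq, exists_prop, eq_comm (b := c)]
    rfl

theorem sum_levelFinset_succ {A : Type*} [AddCommMonoid A] (p : SetPartition n) (l : ℕ)
    (f : SetPartition (n + (l + 1)) → A) :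
    ∑ t ∈ p.levelFinset (l + 1), f t =
      ∑ q ∈ p.levelFinset l, (f (q.child none) + ∑ b ∈ q.openers, f (q.child (some b))) := by
  classical
  rw [levelFinset, sum_biUnion]
  · refine sum_congr rfl fun q _ => ?_
    rw [sum_image (q.child_injOn), sum_insertNone]
  · intro q _ q' _ hne
    simp only [Function.onFun, disjoint_left, mem_image, not_exists, not_and]
    rintro _ ⟨o, -, rfl⟩ o' - h
    exact hne (eq_of_child_eq h.symm)

/-- The numbers of blocks and of crossings of the partitions in `level p l`. -/
noncomputable def levelStat (p : SetPartition n) (l : ℕ) : Multiset (ℕ × ℕ) :=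
  (p.levelFinset l).val.map fun t => (#t.parts, cr t)

theorem simCr_iff {p q : SetPartition n} :
    SimCr p q ↔ ∀ l, p.levelStat l = q.levelStat l := by
  classical
  have key : ∀ (p : SetPartition n) (l m c : ℕ),
      {t ∈ level p l | #t.parts = m ∧ cr t = c}.ncard = (p.levelStat l).count (m, c) := by
    intro p l m c
    rw [levelStat, Multiset.count_map, ← coe_levelFinset, ← filter_val, card_val,
      ← Set.ncard_coe_finset]
    congr 1
    ext t
    simp [eq_comm]
  simp only [SimCr, key, Multiset.ext, Prod.forall]

section GeneratingPolynomial

open Polynomial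

variable {R : Type*} [CommRing R]

/-- The product of `1 + a ^ u X` over the elements `u` of `crset p`. -/
noncomputable def crsetPoly (a : R) (p : SetPartition n) : R[X] :=
  ∏ b ∈ p.openers, (1 + C (a ^ uStat p b) * X)

theorem crsetPoly_eq (a : R) (p : SetPartition n) :
    p.crsetPoly a = ((crset p).map fun u => 1 + C (a ^ u) * X).prod := by
  rw [crset_eq, Multiset.map_map]
  rfl

theorem crsetPoly_child_none (a : R) (p : SetPartition n) :
    (p.child none).crsetPoly a = (1 + X) * p.crsetPoly a := by
  rw [crsetPoly, openers_child (by simp), prod_cons, prod_map]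
  simp [crsetPoly]

theorem crsetPoly_child_some (a : R) {p : SetPartition n} {b : Fin n} (hb : b ∈ p.openers) :
    (p.child (some b)).crsetPoly a = (1 + X) *
      ((∏ x ∈ p.openers with x < b, (1 + C (a ^ uStat p x) * (C a * X))) *
        ∏ x ∈ p.openers with b < x, (1 + C (a ^ uStat p x) * X)) := by
  rw [crsetPoly, openers_child (by simpa using hb), prod_cons, prod_map]
  congr 1
  · simp
  · rw [← prod_filter_mul_prod_filter_not _ (· < b), filter_filter, filter_filter]
    congr 1
    · refine prod_congr (by ext; simp; grind) fun x hx => ?_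
      rw [Fin.coe_succEmb, Fin.val_succ, uStat_child_some hb, if_pos (by simp_all), pow_succ, C_mul,
        mul_assoc]
    · refine prod_congr (by ext; simp; grind) fun x hx => ?_
      rw [Fin.coe_succEmb, Fin.val_succ, uStat_child_some hb,
        if_neg (not_lt.2 (le_of_lt (by simp_all))), add_zero]

theorem sum_crsetPoly_child_some (a : R) (p : SetPartition n) :
    C (a - 1) * X * ∑ b ∈ p.openers, C (a ^ uStat p b) * (p.child (some b)).crsetPoly a =
      (1 + X) * ((p.crsetPoly a).comp (C a * X) - p.crsetPoly a) := by
  have h : (p.crsetPoly a).comp (C a * X) = ∏ b ∈ p.openers,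
      ((1 + C (a ^ uStat p b) * X) + C (a - 1) * X * C (a ^ uStat p b)) := by
    rw [crsetPoly, Polynomial.prod_comp]
    refine prod_congr rfl fun b _ => ?_
    simp only [add_comp, one_comp, mul_comp, C_comp, X_comp, C_sub, C_1]
    ring
  rw [h, prod_add_ordered, ← crsetPoly, add_sub_cancel_left, mul_sum, mul_sum]
  refine sum_congr rfl fun b hb => ?_
  rw [crsetPoly_child_some a hb]
  have : ∀ x, (1 + C (a ^ uStat p x) * X) + C (a - 1) * X * C (a ^ uStat p x) =
      1 + C (a ^ uStat p x) * (C a * X) := fun x => by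
    simp only [C_sub, C_1]
    ring
  simp only [this]
  ring

/-- The generating polynomial of the partitions in `level p l` by number of crossings,
number of blocks and `crset`. -/
noncomputable def levelPoly (a y : R) (p : SetPartition n) (l : ℕ) : R[X] :=
  ∑ t ∈ p.levelFinset l, C (a ^ cr t * y ^ #t.parts) * t.crsetPoly a

theorem levelPoly_succ (a y : R) (p : SetPartition n) (l : ℕ) :
    C (a - 1) * X * p.levelPoly a y (l + 1) =
      (1 + X) * (C (a - 1) * X * C y * p.levelPoly a y l +
        ((p.levelPoly a y l).comp (C a * X) - p.levelPoly a y l)) := by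
  simp only [levelPoly, sum_levelFinset_succ, mul_sum, Polynomial.sum_comp,
    ← sum_sub_distrib, ← sum_add_distrib]
  refine sum_congr rfl fun t _ => ?_
  have h : ∑ b ∈ t.openers, C (a ^ cr (t.child (some b)) * y ^ #(t.child (some b)).parts) *
      (t.child (some b)).crsetPoly a = C (a ^ cr t * y ^ #t.parts) *
        ∑ b ∈ t.openers, C (a ^ uStat t b) * (t.child (some b)).crsetPoly a := by
    rw [mul_sum]
    refine sum_congr rfl fun b hb => ?_
    rw [cr_child_some hb, card_parts_child_some hb]
    simp only [pow_add, C_mul]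
    ring
  rw [h, crsetPoly_child_none, cr_child_none, card_parts_child_none]
  simp only [mul_comp, C_comp, pow_succ, C_mul]
  linear_combination C (a ^ cr t) * C (y ^ #t.parts) * sum_crsetPoly_child_some a t

theorem levelPoly_eq_of_zero [IsDomain R] {a : R} (ha : a ≠ 1) {y : R} {p q : SetPartition n}
    (h : p.levelPoly a y 0 = q.levelPoly a y 0) (l : ℕ) :
    p.levelPoly a y l = q.levelPoly a y l := by
  induction l with
  | zero => exact h
  | succ l ih =>
    refine mul_left_cancel₀ (a := C (a - 1) * X) ?_ ?_
    · exact mul_ne_zero (C_ne_zero.2 (sub_ne_zero.2 ha)) X_ne_zero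
    · rw [levelPoly_succ, levelPoly_succ, ih]

theorem levelPoly_zero (a y : R) (p : SetPartition n) :
    p.levelPoly a y 0 = C (a ^ cr p * y ^ (crset p).card) *
      ((crset p).map fun u => 1 + C (a ^ u) * X).prod := by
  rw [← crsetPoly_eq, crset, Multiset.card_map, card_val]
  exact sum_singleton _ _

theorem coeff_zero_levelPoly (a y : R) (p : SetPartition n) (l : ℕ) :
    (p.levelPoly a y l).coeff 0 = ((p.levelStat l).map fun s => a ^ s.2 * y ^ s.1).sum := by
  rw [levelPoly, finsetSum_coeff, levelStat, Multiset.map_map]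
  refine sum_congr rfl fun t _ => ?_
  simp [crsetPoly, coeff_zero_prod, -map_mul, -map_pow]

theorem count_eq_coeff (s : Multiset (ℕ × ℕ)) (m c : ℕ) :
    (s.count (m, c) : ℤ) =
      ((s.map fun x : ℕ × ℕ => (C X : ℤ[X][X]) ^ x.2 * X ^ x.1).sum.coeff m).coeff c := by
  induction s using Multiset.induction with
  | empty => simp
  | cons x s ih =>
    rw [Multiset.map_cons, Multiset.sum_cons, coeff_add, coeff_add, ← ih, Multiset.count_cons,
      ← C_pow, coeff_C_mul_X_pow]
    obtain ⟨m', c'⟩ := x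
    split_ifs <;> simp_all [coeff_X_pow, add_comm]

theorem levelStat_eq_of_crset_eq {p q : SetPartition n} (hcr : cr p = cr q)
    (hcrset : crset p = crset q) (l : ℕ) : p.levelStat l = q.levelStat l := by
  have h := levelPoly_eq_of_zero (a := (C X : ℤ[X][X])) (y := X) (p := p) (q := q)
    (fun h => X_ne_C 1 (C_injective h))
    (by rw [levelPoly_zero, levelPoly_zero, hcr, hcrset]) l
  ext ⟨m, c⟩
  rw [← Nat.cast_inj (R := ℤ), count_eq_coeff, count_eq_coeff, ← coeff_zero_levelPoly, h,
    coeff_zero_levelPoly]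

end GeneratingPolynomial

theorem levelStat_zero (p : SetPartition n) : p.levelStat 0 = {(#p.parts, cr p)} := rfl

theorem levelStat_one (p : SetPartition n) :
    p.levelStat 1 = (#p.parts + 1, cr p) ::ₘ (crset p).map fun u => (#p.parts, cr p + u) := by
  have hsum : ∀ {ι : Type} (s : Finset ι) (f : ι → ℕ × ℕ),
      ∑ t ∈ s, ({f t} : Multiset (ℕ × ℕ)) = s.val.map f := fun s f => by
    rw [← Multiset.sum_map_singleton (s.val.map f), Multiset.map_map]
    rfl
  rw [levelStat, ← hsum, sum_levelFinset_succ]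
  refine (sum_singleton _ _).trans ?_
  rw [hsum, crset_eq, Multiset.map_map, cr_child_none, card_parts_child_none,
    Multiset.singleton_add]
  congr 1
  refine Multiset.map_congr rfl fun b hb => ?_
  rw [cr_child_some (mem_def.2 hb), card_parts_child_some (mem_def.2 hb), Function.comp_apply]

theorem eq_of_levelStat_eq {p q : SetPartition n} (h : ∀ l, p.levelStat l = q.levelStat l) :
    cr p = cr q ∧ crset p = crset q := by
  have h0 := h 0
  rw [levelStat_zero, levelStat_zero, Multiset.singleton_inj, Prod.mk.injEq] at h0
  have h1 := h 1
  rw [levelStat_one, levelStat_one, h0.1, h0.2, Multiset.cons_inj_right] at h1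
  exact ⟨h0.2, Multiset.map_injective (fun u v huv => by simpa using huv) h1⟩

end SetPartition

/-- For partitions `p, q` of `[n]` (`n ≥ 1`): `p ∼_cr q` if and only if
`cr p = cr q` and `crset p = crset q` as multisets. -/
theorem statement11 {n : ℕ} (hn : 1 ≤ n) (p q : SetPartition n) :
    SimCr p q ↔ cr p = cr q ∧ crset p = crset q := by
  exact SetPartition.simCr_iff.trans ⟨SetPartition.eq_of_levelStat_eq, fun h =>
    SetPartition.levelStat_eq_of_crset_eq h.1 h.2⟩
end

section
/- Let n ≥ k ≥ 1 and set m = min(n−k, k−1). The number of equivalence classes of the relation ∼_cr on Π_{n,k} equals Σ_{l=0}^{m} C(k−1, l) · ((n−k−1)l − l(l−1)/2 + 1), where C(k−1,l) is a binomial coefficient. -/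
open Finset

/-- The ways to remove one entry from a list, the entries in front of it being increased by one;
each result is recorded together with the removed entry. -/
def raisedErasures : List ℕ → List (ℕ × List ℕ)
  | [] => []
  | a :: L => (a, L) :: (raisedErasures L).map fun e => (e.1, (a + 1) :: e.2)

/-- The states of the children of a partition with state `s`, where the state of a partition
consists of its number of crossings and of the numbers of arcs over its block minima. -/
def childStates (s : ℕ × List ℕ) : List (ℕ × List ℕ) :=
  (s.1, 0 :: s.2) :: (raisedErasures s.2).map fun e => (s.1 + e.1, 0 :: e.2)

/-- The states of the descendants, `l` generations down, of a partition with state `s`. -/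
def levelStates (s : ℕ × List ℕ) : ℕ → Multiset (ℕ × List ℕ)
  | 0 => {s}
  | l + 1 => (levelStates s l).bind fun t => (childStates t : Multiset (ℕ × List ℕ))

theorem levelStates_succ' (s : ℕ × List ℕ) (l : ℕ) :
    levelStates s (l + 1) =
      (childStates s : Multiset (ℕ × List ℕ)).bind fun t => levelStates t l := by
  induction l with
  | zero =>
    simp only [levelStates, Multiset.singleton_bind]
    exact ((Multiset.bind_singleton _ id).trans (Multiset.map_id _)).symm
  | succ l ih =>
    rw [levelStates, ih, Multiset.bind_assoc]
    rfl

theorem length_of_mem_raisedErasures {L : List ℕ} {e : ℕ × List ℕ}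
    (h : e ∈ raisedErasures L) : e.2.length + 1 = L.length := by
  induction L generalizing e with
  | nil => simp [raisedErasures] at h
  | cons a L ih =>
    rw [raisedErasures, List.mem_cons, List.mem_map] at h
    rcases h with rfl | ⟨e, he, rfl⟩
    · rfl
    · simp [ih he]

theorem map_fst_raisedErasures (L : List ℕ) : (raisedErasures L).map Prod.fst = L := by
  induction L with
  | nil => rfl
  | cons a L ih => simpa [raisedErasures, Function.comp_def] using ih

theorem mem_raisedErasures_append (A B : List ℕ) (x : ℕ) :
    (x, A.map (· + 1) ++ B) ∈ raisedErasures (A ++ x :: B) := by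
  induction A with
  | nil => simp [raisedErasures]
  | cons a A ih =>
    simp only [List.cons_append, raisedErasures, List.mem_cons, List.mem_map]
    exact Or.inr ⟨_, ih, rfl⟩

section GeneratingFunction

open Polynomial

variable {R : Type*} [CommRing R]

/-- The `q`-derivative of polynomials. -/
noncomputable def qDeriv (q : R) : R[X] →ₗ[R] R[X] :=
  Polynomial.lsum fun n => (∑ i ∈ range n, q ^ i) • monomial (n - 1)

theorem qDeriv_monomial (q a : R) (n : ℕ) :
    qDeriv q (monomial n a) = monomial (n - 1) ((∑ i ∈ range n, q ^ i) * a) := by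
  simp [qDeriv, lsum_apply, sum_monomial_index, smul_monomial]

theorem qDeriv_X_mul (q : R) (P : R[X]) :
    qDeriv q (X * P) = P + C q * X * qDeriv q P := by
  induction P using Polynomial.induction_on' with
  | add P Q hP hQ => rw [mul_add, map_add, hP, hQ, map_add]; ring
  | monomial n a =>
    rw [X_mul_monomial, qDeriv_monomial, qDeriv_monomial, mul_assoc, X_mul_monomial,
      C_mul_monomial]
    rcases n with _ | n
    · simp
    · have h : ∑ i ∈ range (n + 2), q ^ i = 1 + q * ∑ i ∈ range (n + 1), q ^ i := by
        rw [Finset.sum_range_succ', mul_sum, add_comm]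
        simp [pow_succ']
      simp only [Nat.add_sub_cancel, h, add_mul, one_mul, map_add, mul_assoc]

theorem qDeriv_one_add_mul (q a : R) (P : R[X]) :
    qDeriv q ((1 + C a * X) * P) = C a * P + (1 + C (q * a) * X) * qDeriv q P := by
  rw [add_mul, one_mul, mul_assoc, map_add, ← smul_eq_C_mul, map_smul, qDeriv_X_mul,
    smul_eq_C_mul, C_mul]
  ring

/-- The polynomial whose coefficients are the elementary symmetric functions of the `q ^ u`
for `u` in `L`. -/
noncomputable def crPoly (q : R) (L : List ℕ) : R[X] :=
  (L.map fun u => 1 + C (q ^ u) * X).prod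

theorem qDeriv_crPoly (q : R) (L : List ℕ) :
    qDeriv q (crPoly q L) =
      ((raisedErasures L).map fun e => C (q ^ e.1) * crPoly q e.2).sum := by
  induction L with
  | nil => simp [crPoly, raisedErasures, ← C_1, ← monomial_zero_left, qDeriv_monomial, -map_one]
  | cons a L ih =>
    have h : crPoly q (a :: L) = (1 + C (q ^ a) * X) * crPoly q L := by simp [crPoly]
    rw [h, qDeriv_one_add_mul, ih, raisedErasures, List.map_cons, List.sum_cons, List.map_map,
      ← List.sum_map_mul_left]
    congr 3
    funext e
    simp only [Function.comp_apply, crPoly, List.map_cons, List.prod_cons, pow_succ']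
    ring

/-- The linear functional that sends `crPoly q L` to the generating function of the `l`-th level. -/
noncomputable def levelFunctional (q y : R) : ℕ → R[X] →ₗ[R] R
  | 0 => lcoeff R 0
  | l + 1 => levelFunctional q y l ∘ₗ
      LinearMap.mulLeft R (1 + X) ∘ₗ (y • LinearMap.id + qDeriv q)

theorem sum_levelStates (q y : R) (l : ℕ) (s : ℕ × List ℕ) :
    ((levelStates s l).map fun t => q ^ t.1 * y ^ t.2.length).sum =
      q ^ s.1 * y ^ s.2.length * levelFunctional q y l (crPoly q s.2) := by
  induction l generalizing s with
  | zero =>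
    have h : (crPoly q s.2).coeff 0 = 1 := by
      simp [crPoly, coeff_zero_eq_eval_zero, eval_list_prod, Function.comp_def]
    simp [levelStates, levelFunctional, h]
  | succ l ih =>
    obtain ⟨c, L⟩ := s
    have h0 (M : List ℕ) : crPoly q (0 :: M) = (1 + X) * crPoly q M := by simp [crPoly]
    rw [levelStates_succ', Multiset.map_bind, Multiset.sum_bind]
    simp only [ih, childStates, Multiset.map_coe, Multiset.sum_coe, List.map_cons, List.sum_cons,
      List.map_map, levelFunctional, LinearMap.comp_apply, LinearMap.add_apply,
      LinearMap.smul_apply, LinearMap.id_apply, LinearMap.mulLeft_apply, qDeriv_crPoly, mul_add,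
      map_add, h0, map_smul, smul_eq_mul, List.length_cons]
    congr 1
    · ring
    · rw [← List.sum_map_mul_left, map_list_sum, List.map_map, ← List.sum_map_mul_left]
      congr 1
      refine List.map_congr_left fun e he => ?_
      have hlen := length_of_mem_raisedErasures he
      rw [← hlen]
      simp only [Function.comp_apply, h0, List.length_cons]
      rw [mul_left_comm (1 + X : R[X]), ← smul_eq_C_mul, map_smul, smul_eq_mul]
      ring

end GeneratingFunction

section Counting

open Polynomial

theorem coeff_coeff_sum_monomial (s : Multiset (ℕ × ℕ)) (c m : ℕ) :
    (((s.map fun t : ℕ × ℕ => (C X : ℤ[X][X]) ^ t.1 * X ^ t.2).sum.coeff m).coeff c) =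
      (s.count (c, m) : ℤ) := by
  induction s using Multiset.induction_on with
  | empty => simp
  | cons t s ih =>
    rw [Multiset.map_cons, Multiset.sum_cons, coeff_add, coeff_add, ih, Multiset.count_cons,
      ← C_pow, coeff_C_mul, coeff_X_pow, mul_ite, mul_one, mul_zero]
    by_cases h : m = t.2 <;> by_cases h' : c = t.1 <;>
      simp [h, h', coeff_X_pow, Prod.ext_iff, add_comm]

end Counting

/-- The joint distribution of crossings and numbers of blocks on the `l`-th level. -/
def levelDistribution (s : ℕ × List ℕ) (l : ℕ) : Multiset (ℕ × ℕ) :=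
  (levelStates s l).map fun t => (t.1, t.2.length)

theorem levelDistribution_congr {s t : ℕ × List ℕ} (h₁ : s.1 = t.1) (h₂ : s.2.Perm t.2) (l : ℕ) :
    levelDistribution s l = levelDistribution t l := by
  ext ⟨c, m⟩
  have hsum (r : ℕ × List ℕ) := sum_levelStates
    (Polynomial.C Polynomial.X : Polynomial (Polynomial ℤ)) Polynomial.X l r
  have hpoly : crPoly (Polynomial.C Polynomial.X : Polynomial (Polynomial ℤ)) s.2 =
      crPoly (Polynomial.C Polynomial.X : Polynomial (Polynomial ℤ)) t.2 := (h₂.map _).prod_eq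
  have := (hsum s).trans ((by rw [h₁, h₂.length_eq, hpoly]) : _ = _) |>.trans (hsum t).symm
  rw [← Nat.cast_inj (R := ℤ), ← coeff_coeff_sum_monomial, ← coeff_coeff_sum_monomial]
  simp only [levelDistribution, Multiset.map_map, Function.comp_def, this]

theorem levelDistribution_eq_iff {s t : ℕ × List ℕ} (hlen : s.2.length = t.2.length) :
    (∀ l, levelDistribution s l = levelDistribution t l) ↔ s.1 = t.1 ∧ s.2.Perm t.2 := by
  refine ⟨fun h => ?_, fun h l => levelDistribution_congr h.1 h.2 l⟩
  have hc : s.1 = t.1 := by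
    have := h 0
    simp only [levelDistribution, levelStates, Multiset.map_singleton,
      Multiset.singleton_inj, Prod.mk.injEq] at this
    exact this.1
  refine ⟨hc, ?_⟩
  have hone (r : ℕ × List ℕ) : levelDistribution r 1 =
      (r.1, r.2.length + 1) ::ₘ ((r.2 : Multiset ℕ).map fun x => (r.1 + x, r.2.length)) := by
    simp only [levelDistribution, levelStates, Multiset.singleton_bind, childStates,
      Multiset.map_coe, List.map_cons, List.map_map, List.length_cons, Multiset.cons_coe]
    conv_rhs => rw [← map_fst_raisedErasures r.2, List.map_map]
    rw [map_fst_raisedErasures]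
    congr 2
    refine List.map_congr_left fun e he => ?_
    simp [length_of_mem_raisedErasures he]
  have h1 := h 1
  rw [hone, hone, hc, hlen, Multiset.cons_inj_right] at h1
  exact Multiset.coe_eq_coe.mp (Multiset.map_injective (fun x y hxy => by simpa using hxy) h1)

/-- `Reachable n s` says that `s` is the state of some partition of `[n]`. -/
def Reachable : ℕ → ℕ × List ℕ → Prop
  | 0, s => s = (0, [])
  | n + 1, s => ∃ t, Reachable n t ∧ s ∈ childStates t

theorem Reachable.cons_zero {n c : ℕ} {L : List ℕ} (h : Reachable n (c, L)) :
    Reachable (n + 1) (c, 0 :: L) :=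
  ⟨_, h, by simp [childStates]⟩

theorem Reachable.join {n c x : ℕ} {A B : List ℕ} (h : Reachable n (c, A ++ x :: B)) :
    Reachable (n + 1) (c + x, 0 :: (A.map (· + 1) ++ B)) := by
  refine ⟨_, h, ?_⟩
  rw [childStates, List.mem_cons, List.mem_map]
  exact Or.inr ⟨_, mem_raisedErasures_append A B x, rfl⟩

theorem Reachable.replicate_append {n c : ℕ} {L : List ℕ} (h : Reachable n (c, L)) (a : ℕ) :
    Reachable (n + a) (c, List.replicate a 0 ++ L) := by
  induction a with
  | zero => exact h
  | succ a ih => exact ih.cons_zero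

/-- The largest number of crossings of a partition with `N` arcs, at most `l` of which pass over
the same block minimum. -/
def maxCr (N l : ℕ) : ℕ := ∑ j ∈ range N, min j l

theorem maxCr_succ (N l : ℕ) : maxCr (N + 1) l = maxCr N l + min N l :=
  Finset.sum_range_succ _ _

theorem maxCr_mono (N : ℕ) {l l' : ℕ} (h : l ≤ l') : maxCr N l ≤ maxCr N l' :=
  Finset.sum_le_sum fun _ _ => min_le_min_left _ h

theorem maxCr_eq {N l : ℕ} (h : l ≤ N) : maxCr N l = (N - 1) * l - l * (l - 1) / 2 := by
  have hdiag (m : ℕ) : maxCr m m = m * (m - 1) / 2 := by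
    rw [← Finset.sum_range_id]
    exact Finset.sum_congr rfl fun j hj => min_eq_left (Finset.mem_range.mp hj).le
  have key (d : ℕ) : maxCr (l + d) l = l * (l - 1) / 2 + d * l := by
    induction d with
    | zero => simp [hdiag]
    | succ d ih => rw [← add_assoc, maxCr_succ, ih, min_eq_right (by omega)]; ring
  obtain ⟨d, rfl⟩ := Nat.exists_eq_add_of_le h
  rw [key]
  rcases l with _ | l
  · simp
  · have h2 : (l + 1) * l / 2 * 2 = (l + 1) * l :=
      Nat.div_mul_cancel (by rw [mul_comm]; exact (Nat.even_mul_succ_self l).two_dvd)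
    have h3 : (l + 1 + d - 1) * (l + 1) = (l + 1) * l + d * (l + 1) := by
      rw [show l + 1 + d - 1 = l + d by omega]; ring
    rw [h3, Nat.add_sub_cancel]
    omega

/-- A list whose first entry is at most `a` and in which each entry exceeds its
predecessor by at most one. -/
def ClimbsFrom : ℕ → List ℕ → Prop
  | _, [] => True
  | a, b :: L => b ≤ a ∧ ClimbsFrom (b + 1) L

theorem ClimbsFrom.mono {a a' : ℕ} {L : List ℕ} (h : ClimbsFrom a L) (ha : a ≤ a') :
    ClimbsFrom a' L := by
  cases L with
  | nil => trivial
  | cons b L => exact ⟨h.1.trans ha, h.2⟩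

theorem ClimbsFrom.raisedErasures {a : ℕ} {L : List ℕ} (h : ClimbsFrom a L)
    {e : ℕ × List ℕ} (he : e ∈ raisedErasures L) : ClimbsFrom (a + 1) e.2 := by
  induction L generalizing a e with
  | nil => simp [_root_.raisedErasures] at he
  | cons b L ih =>
    rw [_root_.raisedErasures, List.mem_cons, List.mem_map] at he
    rcases he with rfl | ⟨e, he, rfl⟩
    · exact h.2.mono (by simpa using h.1)
    · exact ⟨by simpa using h.1, ih h.2 he⟩

theorem ClimbsFrom.mem_of_le {a x y : ℕ} {L : List ℕ} (h : ClimbsFrom a L) (hx : x ∈ L)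
    (hay : a ≤ y) (hyx : y ≤ x) : y ∈ L := by
  induction L generalizing a with
  | nil => simp at hx
  | cons b L ih =>
    have hb := h.1
    rcases eq_or_ne y b with rfl | hne
    · simp
    · rcases List.mem_cons.mp hx with rfl | hx
      · omega
      · exact List.mem_cons_of_mem _ (ih h.2 hx (by omega))

theorem ClimbsFrom.le_or_exists_le {a z : ℕ} {L : List ℕ} (h : ClimbsFrom a L) (hz : z ∈ L)
    {e : ℕ × List ℕ} (he : e ∈ _root_.raisedErasures L) : z ≤ a ∨ ∃ z' ∈ e.2, z ≤ z' := by
  induction L generalizing a e with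
  | nil => simp at hz
  | cons b L ih =>
    rw [_root_.raisedErasures, List.mem_cons, List.mem_map] at he
    rcases he with rfl | ⟨e, he, rfl⟩
    · rcases List.mem_cons.mp hz with rfl | hz
      · exact Or.inl h.1
      · exact Or.inr ⟨z, hz, le_rfl⟩
    · right
      rcases List.mem_cons.mp hz with rfl | hz
      · exact ⟨z + 1, by simp, by omega⟩
      · rcases ih h.2 hz he with hle | ⟨z', hz', hle⟩
        · exact ⟨b + 1, by simp, hle⟩
        · exact ⟨z', by simp [hz'], hle⟩

theorem mem_or_le_of_mem_raisedErasures {l z : ℕ} {L : List ℕ} (hL : ∀ x ∈ L, x ≤ l)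
    {e : ℕ × List ℕ} (he : e ∈ raisedErasures L) : e.1 ∈ L ∧ (z ∈ e.2 → z ≤ l + 1) := by
  induction L generalizing e with
  | nil => simp [raisedErasures] at he
  | cons b L ih =>
    rw [raisedErasures, List.mem_cons, List.mem_map] at he
    rcases he with rfl | ⟨e, he, rfl⟩
    · exact ⟨by simp, fun hz => (hL z (by simp [hz])).trans (by omega)⟩
    · obtain ⟨h₁, h₂⟩ := ih (fun x hx => hL x (by simp [hx])) he
      refine ⟨by simp [h₁], fun hz => ?_⟩
      rcases List.mem_cons.mp hz with rfl | hz
      · simpa using hL b (by simp)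
      · exact h₂ hz

theorem Reachable.bounds {n : ℕ} {s : ℕ × List ℕ} (h : Reachable n s) :
    ClimbsFrom 0 s.2 ∧ ∃ N l, n = N + s.2.length ∧ (∀ x ∈ s.2, x ≤ l) ∧ l ≤ N ∧
      s.1 ≤ maxCr N l ∧ (l = 0 ∨ l ∈ s.2) := by
  induction n generalizing s with
  | zero =>
    obtain rfl : s = (0, []) := h
    exact ⟨trivial, 0, 0, by simp⟩
  | succ n ih =>
    obtain ⟨⟨c, L⟩, ht, hs⟩ := h
    obtain ⟨hclimb, N, l, hn, hle, hlN, hc, hmem⟩ := ih ht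
    dsimp only at hclimb hn hle hc hmem
    rw [childStates, List.mem_cons, List.mem_map] at hs
    rcases hs with rfl | ⟨e, he, rfl⟩
    · refine ⟨⟨le_rfl, hclimb.mono (by simp)⟩, N, l, ?_, ?_, hlN, hc, ?_⟩
      · simp only [List.length_cons]; omega
      · simpa using hle
      · exact hmem.imp_right fun h => by simp [h]
    · refine ⟨⟨le_rfl, hclimb.raisedErasures he⟩, ?_⟩
      have hlen : e.2.length + 1 = L.length := length_of_mem_raisedErasures he
      have hmem' := mem_or_le_of_mem_raisedErasures (z := 0) hle he
      have he1 : e.1 ≤ l := hle _ hmem'.1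
      have hstep (l' : ℕ) (hl' : l ≤ l') : c + e.1 ≤ maxCr (N + 1) l' := by
        rw [maxCr_succ]
        exact Nat.add_le_add (hc.trans (maxCr_mono N hl')) (le_min (by omega) (by omega))
      by_cases hl1 : l + 1 ∈ e.2
      · refine ⟨N + 1, l + 1, ?_, ?_, by omega, hstep _ (by omega), Or.inr (by simp [hl1])⟩
        · simp only [List.length_cons]; omega
        · simpa using fun x hx => (mem_or_le_of_mem_raisedErasures hle he).2 hx
      · have hle' : ∀ x ∈ e.2, x ≤ l := fun x hx => by
          have := (mem_or_le_of_mem_raisedErasures hle he).2 hx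
          have hne : x ≠ l + 1 := fun h => hl1 (h ▸ hx)
          omega
        refine ⟨N + 1, l, ?_, by simpa using hle', by omega, hstep _ le_rfl, ?_⟩
        · simp only [List.length_cons]; omega
        · rcases hmem with h0 | hmem
          · exact Or.inl h0
          · rcases hclimb.le_or_exists_le hmem he with h0 | ⟨z, hz, hlz⟩
            · exact Or.inl (by omega)
            · obtain rfl : z = l := le_antisymm (hle' z hz) hlz
              exact Or.inr (by simp [hz])

/-- The weakly increasing list in which `j` occurs `cs[j] + 1` times, for `j < cs.length`. -/
def stairs : List ℕ → List ℕ
  | [] => []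
  | a :: cs => List.replicate (a + 1) 0 ++ (stairs cs).map (· + 1)

theorem stairs_append (A B : List ℕ) :
    stairs (A ++ B) = stairs A ++ (stairs B).map (· + A.length) := by
  induction A with
  | nil => simp [stairs]
  | cons a A ih =>
    simp [stairs, ih, List.map_append, Function.comp_def, add_assoc]

theorem length_stairs (cs : List ℕ) : (stairs cs).length = cs.sum + cs.length := by
  induction cs with
  | nil => rfl
  | cons a cs ih => simp [stairs, ih]; omega

theorem stairs_concat_succ (A : List ℕ) (a : ℕ) :
    stairs (A ++ [a + 1]) = stairs (A ++ [a]) ++ [A.length] := by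
  rw [stairs_append, stairs_append]
  simp [stairs, List.replicate_succ' (n := a + 1)]

theorem Reachable.stairs_cons {n c a : ℕ} {cs : List ℕ}
    (h : Reachable n (c, stairs (0 :: cs))) : Reachable (n + a) (c, stairs (a :: cs)) := by
  have := h.replicate_append a
  simpa [stairs, List.replicate_add] using this

theorem Reachable.of_insert_zero {n c : ℕ} {A B : List ℕ}
    (h : Reachable n (c, stairs (A ++ 0 :: B))) :
    Reachable (n + 1) (c + A.length, stairs (0 :: (A ++ B))) := by
  have h' : stairs (A ++ 0 :: B) =
      stairs A ++ A.length :: (stairs B).map (· + (A.length + 1)) := by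
    rw [stairs_append]
    simp [stairs, Function.comp_def, add_assoc, add_comm 1]
  rw [h'] at h
  have := h.join
  simpa [stairs, stairs_append, Function.comp_def, add_assoc] using this

theorem reachable_stairs_pool (cs : List ℕ) {y : ℕ} (hy : y + 1 ≤ cs.length) (z : ℕ) :
    Reachable (2 * cs.length + cs.sum + z)
      (0, stairs cs ++ y :: List.replicate z 0) := by
  induction cs generalizing y z with
  | nil => simp at hy
  | cons a cs ih =>
    have key : Reachable (2 * cs.length + 1 + cs.sum + (z + 1))
        (0, 0 :: ((stairs cs).map (· + 1) ++ y :: List.replicate z 0)) := by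
      rcases Nat.eq_zero_or_pos cs.length with h0 | hpos
      · obtain rfl : cs = [] := List.length_eq_zero_iff.mp h0
        obtain rfl : y = 0 := by simpa using hy
        have h := Reachable.replicate_append (n := 0) (c := 0) (L := []) rfl (z + 2)
        simpa [stairs, List.replicate_succ, add_comm, add_left_comm] using h
      · rcases y with _ | y
        · have h := (ih (y := 0) hpos (z + 1)).join
          rw [List.replicate_succ] at h
          convert h using 1
          ring
        · have h := ih (y := y) (by simpa using hy) (z + 1)
          have h' := Reachable.join (A := stairs cs ++ [y]) (x := 0)
            (B := List.replicate z 0) (by simpa [List.replicate_succ] using h)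
          convert h' using 1
          · ring
          · simp
    have h := key.replicate_append a
    convert h using 1
    · simp; ring
    · simp [stairs, List.replicate_succ']

theorem reachable_stairs (N : ℕ) (cs : List ℕ) (hcs : cs ≠ []) (hN : cs.length ≤ N + 1) {c : ℕ}
    (hc : c ≤ maxCr N (cs.length - 1)) :
    Reachable (N + cs.length + cs.sum) (c, stairs cs) := by
  induction N generalizing cs c with
  | zero =>
    obtain ⟨a, rfl⟩ : ∃ a, cs = [a] := List.length_eq_one_iff.mp
      (le_antisymm hN (List.length_pos_iff.mpr hcs))
    obtain rfl : c = 0 := by simpa [maxCr] using hc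
    have h := Reachable.replicate_append (n := 0) (c := 0) (L := []) rfl (a + 1)
    simpa [stairs, add_comm] using h
  | succ N ih =>
    obtain ⟨a, cs, rfl⟩ := List.exists_cons_of_ne_nil hcs
    have hlen : cs.length ≤ N + 1 := by simpa using hN
    simp only [List.length_cons, Nat.add_sub_cancel] at hc
    suffices h : Reachable (N + (cs.length + 1) + cs.sum + 1) (c, stairs (0 :: cs)) by
      have := h.stairs_cons (a := a)
      convert this using 1
      simp only [List.length_cons, List.sum_cons]
      ring
    rw [maxCr_succ] at hc
    rcases hlen.lt_or_eq with hlt | heq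
    · rw [min_eq_right (by omega)] at hc
      obtain ⟨i, hi, hci, hcm⟩ : ∃ i, i ≤ cs.length ∧ i ≤ c ∧ c - i ≤ maxCr N cs.length :=
        ⟨min c cs.length, by omega, by omega, by omega⟩
      have h := ih (cs.take i ++ 0 :: cs.drop i) (by simp) (by simp; omega)
        (c := c - i) (by simpa [hi] using hcm)
      have h' := h.of_insert_zero
      have hsum : (cs.take i).sum + (cs.drop i).sum = cs.sum := by
        rw [← List.sum_append, List.take_append_drop]
      convert h' using 1
      · simp; omega
      · simp [hi, hci]
    · rw [min_eq_left (by omega)] at hc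
      have hne : cs ≠ [] := by rintro rfl; simp at heq
      have hshift : stairs (0 :: cs) = 0 :: (stairs cs).map (· + 1) := by simp [stairs]
      rcases le_total c N with hcN | hcN
      · have h := Reachable.join (reachable_stairs_pool cs (y := c) (by omega) 0)
        convert h using 1
        · omega
        · simp [hshift]
      · obtain ⟨A, b, rfl⟩ : ∃ A b, cs = A ++ [b] :=
          ⟨_, _, (List.dropLast_append_getLast hne).symm⟩
        have hA : A.length = N := by simpa using heq
        have hdiag : maxCr N (N + 1) = maxCr N N :=
          Finset.sum_congr rfl fun j hj => by have := Finset.mem_range.mp hj; omega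
        have h := ih (A ++ [b + 1]) (by simp) (by simp [hA]) (c := c - N)
          (by rw [heq] at hc; simp only [List.length_append, hA, List.length_singleton,
                Nat.add_sub_cancel]; omega)
        rw [stairs_concat_succ, hA] at h
        have h' := Reachable.join h
        convert h' using 1
        · simp [hA]; omega
        · simp [hshift, hcN]

theorem count_stairs (cs : List ℕ) (j : ℕ) :
    (stairs cs).count j = if h : j < cs.length then cs[j] + 1 else 0 := by
  induction cs generalizing j with
  | nil => simp [stairs]
  | cons a cs ih =>
    rw [stairs, List.count_append]
    rcases j with _ | j
    · have : (List.map (· + 1) (stairs cs)).count 0 = 0 := List.count_eq_zero.mpr (by simp)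
      simp [this]
    · rw [List.count_map_of_injective (stairs cs) (· + 1) (add_left_injective 1) j, ih]
      simp [List.count_replicate]

theorem exists_coe_stairs_eq {d : ℕ} {M : Multiset ℕ} (h : ∀ x ∈ M, x < d) :
    ∃ cs : List ℕ, cs.length = d ∧ (stairs cs : Multiset ℕ) = Multiset.range d + M := by
  refine ⟨(List.range d).map M.count, by simp, ?_⟩
  ext j
  rw [Multiset.coe_count, count_stairs, Multiset.count_add]
  by_cases hj : j < d
  · simp [hj, Multiset.count_eq_one_of_mem (Multiset.nodup_range d), add_comm]
  · simp [hj, Multiset.count_eq_zero_of_notMem (fun hm => hj (h j hm))]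

theorem exists_reachable_iff {N k c : ℕ} (hk : 1 ≤ k) {M : Multiset ℕ} :
    (∃ L : List ℕ, Reachable (N + k) (c, L) ∧ (L : Multiset ℕ) = M ∧ L.length = k) ↔
      ∃ l, l ≤ min N (k - 1) ∧ c ≤ maxCr N l ∧
        ∃ M' : Multiset ℕ, (∀ x ∈ M', x < l + 1) ∧ M'.card = k - 1 - l ∧
          M = Multiset.range (l + 1) + M' := by
  constructor
  · rintro ⟨L, hL, rfl, hlen⟩
    obtain ⟨hclimb, N', l, hn, hle, hlN, hc, hmem⟩ := hL.bounds
    dsimp only at hclimb hn hle hc hmem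
    obtain rfl : N' = N := by omega
    have hlmem : l ∈ L := by
      rcases hmem with rfl | hmem
      · obtain ⟨x, hx⟩ := List.exists_mem_of_length_pos (show 0 < L.length by omega)
        obtain rfl : x = 0 := by simpa using hle x hx
        exact hx
      · exact hmem
    have hsub : Multiset.range (l + 1) ≤ (L : Multiset ℕ) :=
      (Multiset.le_iff_subset (Multiset.nodup_range _)).mpr fun x hx =>
        hclimb.mem_of_le hlmem (Nat.zero_le _) (Nat.lt_succ_iff.mp (Multiset.mem_range.mp hx))
    obtain ⟨M', hM'⟩ := Multiset.le_iff_exists_add.mp hsub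
    have hcard : L.length = l + 1 + M'.card := by
      simpa [add_right_comm] using congrArg Multiset.card hM'
    refine ⟨l, by omega, hc, M', fun x hx => Nat.lt_succ_of_le (hle x ?_), by omega, hM'⟩
    rw [← Multiset.mem_coe, hM']
    exact Multiset.mem_add.mpr (Or.inr hx)
  · rintro ⟨l, hl, hc, M', hM', hcard, rfl⟩
    obtain ⟨cs, hlen, hcs⟩ := exists_coe_stairs_eq hM'
    have hcard_stairs : (stairs cs).length = k := by
      rw [← Multiset.coe_card, hcs, Multiset.card_add, Multiset.card_range]
      omega
    have hne : cs ≠ [] := by rintro rfl; simp at hlen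
    have h := reachable_stairs N cs hne (by omega) (c := c) (by simpa [hlen] using hc)
    rw [length_stairs] at hcard_stairs
    exact ⟨stairs cs, by convert h using 1; omega, hcs, by rwa [length_stairs]⟩

/-- The pairs of a number of crossings and a multiset of numbers of arcs over block minima that
occur for partitions with `N` arcs and `k` blocks. -/
def crPairs (N k : ℕ) : Finset (ℕ × Multiset ℕ) :=
  (range (min N (k - 1) + 1)).biUnion fun l =>
    range (maxCr N l + 1) ×ˢ
      univ.image fun M : Sym (Fin (l + 1)) (k - 1 - l) =>
        Multiset.range (l + 1) + (M : Multiset (Fin (l + 1))).map Fin.val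

theorem mem_crPairs {N k c : ℕ} (hk : 1 ≤ k) {M : Multiset ℕ} :
    (c, M) ∈ crPairs N k ↔
      ∃ L : List ℕ, Reachable (N + k) (c, L) ∧ (L : Multiset ℕ) = M ∧ L.length = k := by
  rw [exists_reachable_iff hk]
  simp only [crPairs, mem_biUnion, Finset.mem_range, mem_product, mem_image, mem_univ, true_and,
    Nat.lt_succ_iff]
  refine exists_congr fun l => and_congr_right fun _ => and_congr_right fun _ => ?_
  constructor
  · rintro ⟨M', rfl⟩
    refine ⟨_, fun x hx => ?_, by simp, rfl⟩
    obtain ⟨i, -, rfl⟩ := Multiset.mem_map.mp hx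
    exact Nat.lt_succ_iff.mp i.2
  · rintro ⟨M', h, hcard, rfl⟩
    refine ⟨⟨M'.pmap (fun x hx => (⟨x, Nat.lt_succ_of_le hx⟩ : Fin (l + 1))) h, by simpa⟩, ?_⟩
    simp [Multiset.map_pmap, Multiset.pmap_eq_map]

theorem card_crPairs {N k : ℕ} (hk : 1 ≤ k) :
    (crPairs N k).card = ∑ l ∈ range (min N (k - 1) + 1),
      (k - 1).choose l * ((N - 1) * l - l * (l - 1) / 2 + 1) := by
  rw [crPairs, card_biUnion]
  · refine Finset.sum_congr rfl fun l hl => ?_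
    have hl' := Finset.mem_range.mp hl
    rw [card_product, card_range, card_image_of_injective, ← maxCr_eq (by omega), mul_comm]
    · rw [card_univ, Sym.card_sym_eq_choose, Fintype.card_fin]
      congr 1
      rw [show l + 1 + (k - 1 - l) - 1 = k - 1 by omega]
      exact Nat.choose_symm (by omega)
    · exact fun M M' h => Sym.coe_injective
        (Multiset.map_injective Fin.val_injective (add_left_cancel h))
  · have hmax {l l' : ℕ} {M : Multiset (Fin (l + 1))} {M' : Multiset (Fin (l' + 1))}
        (h : Multiset.range (l + 1) + M.map Fin.val = Multiset.range (l' + 1) + M'.map Fin.val) :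
        l ≤ l' := by
      have : l ∈ Multiset.range (l' + 1) + M'.map Fin.val := by rw [← h]; simp
      rcases Multiset.mem_add.mp this with hl | hl
      · exact Nat.lt_succ_iff.mp (Multiset.mem_range.mp hl)
      · obtain ⟨i, -, rfl⟩ := Multiset.mem_map.mp hl
        exact Nat.lt_succ_iff.mp i.2
    intro l _ l' _ hne
    rw [Function.onFun, disjoint_left]
    rintro ⟨c, M⟩ h h'
    simp only [mem_product, mem_image] at h h'
    obtain ⟨_, M₁, -, rfl⟩ := h
    obtain ⟨_, M₂, -, heq⟩ := h'
    exact hne (le_antisymm (hmax heq.symm) (hmax heq))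

section Partition

variable {n : ℕ} (p : SetPartition n)

theorem inSameBlock_iff_mem_part {i j : Fin n} : InSameBlock p i j ↔ j ∈ p.part i := by
  rw [p.mem_part_iff_exists]
  simp only [InSameBlock]
  exact exists_congr fun B => and_congr_right fun _ => and_comm

theorem inSameBlock_refl (i : Fin n) : InSameBlock p i i :=
  (inSameBlock_iff_mem_part p).mpr (p.mem_part_self.mpr (mem_univ i))

variable {p} in
theorem InSameBlock.symm {i j : Fin n} (h : InSameBlock p i j) : InSameBlock p j i := by
  obtain ⟨B, hB, hi, hj⟩ := h
  exact ⟨B, hB, hj, hi⟩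

variable {p} in
theorem InSameBlock.trans {i j k : Fin n} (h : InSameBlock p i j) (h' : InSameBlock p j k) :
    InSameBlock p i k := by
  obtain ⟨B, hB, hi, hj⟩ := h
  obtain ⟨B', hB', hj', hk⟩ := h'
  obtain rfl := p.eq_of_mem_parts hB hB' hj hj'
  exact ⟨B, hB, hi, hk⟩

theorem ext_inSameBlock {p q : SetPartition n}
    (h : ∀ i j, InSameBlock p i j ↔ InSameBlock q i j) : p = q := by
  have hpart (i : Fin n) : p.part i = q.part i := by
    ext j
    rw [← inSameBlock_iff_mem_part, ← inSameBlock_iff_mem_part, h]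
  have hparts (r : SetPartition n) : r.parts = univ.image r.part := by
    ext B
    simp only [mem_image, mem_univ, true_and]
    constructor
    · intro hB
      obtain ⟨i, hi⟩ := r.nonempty_of_mem_parts hB
      exact ⟨i, r.part_eq_of_mem hB hi⟩
    · rintro ⟨i, rfl⟩
      exact r.part_mem.mpr (mem_univ i)
  ext1
  rw [hparts, hparts]
  exact image_congr fun i _ => hpart i

theorem exists_setPartition (s : Setoid (Fin n)) :
    ∃ p : SetPartition n, ∀ i j, InSameBlock p i j ↔ s i j := by
  classical
  exact ⟨Finpartition.ofSetoid s, fun i j => by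
    rw [inSameBlock_iff_mem_part, Finpartition.mem_part_ofSetoid_iff_rel]⟩

theorem isArc_iff {i j : Fin n} :
    IsArc p i j ↔ i < j ∧ InSameBlock p i j ∧ ∀ x, InSameBlock p i x → ¬ (i < x ∧ x < j) := by
  refine and_congr_right fun _ => ⟨?_, ?_⟩
  · rintro ⟨B, hB, hi, hj, h⟩
    refine ⟨⟨B, hB, hi, hj⟩, fun x hx => h x ?_⟩
    obtain ⟨B', hB', hi', hx⟩ := hx
    rwa [p.eq_of_mem_parts hB hB' hi hi']
  · rintro ⟨⟨B, hB, hi, hj⟩, h⟩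
    exact ⟨B, hB, hi, hj, fun x hx => h x ⟨B, hB, hi, hx⟩⟩

/-- `i` is the minimum of its block. -/
def IsBlockMin (i : Fin n) : Prop := ∀ j, InSameBlock p j i → i ≤ j

open Classical in
/-- The block minima, in increasing order. -/
noncomputable def blockMins : List (Fin n) := (List.finRange n).filter fun i => IsBlockMin p i

/-- The state of a partition: its number of crossings and the numbers of arcs over its block
minima, from left to right. -/
noncomputable def crState : ℕ × List ℕ := (cr p, (blockMins p).map fun i : Fin n => uStat p i)

theorem mem_blockMins {i : Fin n} : i ∈ blockMins p ↔ IsBlockMin p i := by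
  simp [blockMins]

theorem blockMins_pairwise : (blockMins p).Pairwise (· < ·) :=
  (List.pairwise_lt_finRange n).filter _

theorem blockMins_nodup : (blockMins p).Nodup := (List.nodup_finRange n).filter _

variable {p} in
theorem minOfBlock_eq {B : Finset (Fin n)} (hB : B ∈ p.parts) :
    ∃ i, IsBlockMin p i ∧ i ∈ B ∧ minOfBlock B = i := by
  refine ⟨B.min' (p.nonempty_of_mem_parts hB), fun j hj => ?_, B.min'_mem _, ?_⟩
  · obtain ⟨B', hB', hj, hi⟩ := hj
    obtain rfl := p.eq_of_mem_parts hB hB' (B.min'_mem _) hi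
    exact B.min'_le j hj
  · refine IsLeast.csInf_eq ⟨⟨_, B.min'_mem _, rfl⟩, ?_⟩
    rintro _ ⟨j, hj, rfl⟩
    exact B.min'_le j hj

theorem map_minOfBlock :
    p.parts.val.map minOfBlock = ((blockMins p).map Fin.val : Multiset ℕ) := by
  have hinj : Set.InjOn minOfBlock (p.parts : Set (Finset (Fin n))) := by
    intro B hB B' hB' h
    obtain ⟨i, -, hi, hBi⟩ := minOfBlock_eq hB
    obtain ⟨i', -, hi', hBi'⟩ := minOfBlock_eq hB'
    obtain rfl : i = i' := Fin.ext (by rw [← hBi, ← hBi', h])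
    exact p.eq_of_mem_parts hB hB' hi hi'
  refine (Multiset.Nodup.ext ?_ ?_).mpr fun a => ?_
  · exact Multiset.Nodup.map_on (fun B hB B' hB' h => hinj hB hB' h) p.parts.nodup
  · exact Multiset.coe_nodup.mpr ((blockMins_nodup p).map Fin.val_injective)
  · simp only [Multiset.mem_map, mem_val, Multiset.mem_coe, List.mem_map, mem_blockMins]
    constructor
    · rintro ⟨B, hB, rfl⟩
      obtain ⟨i, hi, -, hBi⟩ := minOfBlock_eq hB
      exact ⟨i, hi, hBi.symm⟩
    · rintro ⟨i, hi, rfl⟩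
      refine ⟨p.part i, p.part_mem.mpr (mem_univ i), ?_⟩
      obtain ⟨j, hj, hjB, hBj⟩ := minOfBlock_eq (p.part_mem.mpr (mem_univ i))
      have hij := (inSameBlock_iff_mem_part p).mpr hjB
      rw [hBj, le_antisymm (hj i hij) (hi j hij.symm)]

theorem length_crState : (crState p).2.length = p.parts.card := by
  have := congrArg Multiset.card (map_minOfBlock p)
  simpa [crState] using this.symm

end Partition

section Child

variable {n : ℕ} {p : SetPartition n} {c : SetPartition (n + 1)}

theorem IsChild.isArc_succ (h : IsChild c p) {i j : Fin n} :
    IsArc c i.succ j.succ ↔ IsArc p i j := by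
  rw [isArc_iff, isArc_iff, h i j, Fin.succ_lt_succ_iff]
  refine and_congr_right fun _ => and_congr_right fun _ => ⟨fun H x hx => ?_, fun H x => ?_⟩
  · simpa using H x.succ ((h i x).mp hx)
  · refine Fin.cases (fun _ => by simp) (fun x hx => ?_) x
    simpa using H x ((h i x).mpr hx)

/-- The child `c` of `p` whose new element `0` is a singleton block or is joined to the
block with a given minimum. -/
def IsChildAt (c : SetPartition (n + 1)) (p : SetPartition n) (o : Option (Fin n)) : Prop :=
  IsChild c p ∧ (∀ j ∈ o, IsBlockMin p j) ∧
    ∀ i : Fin n, InSameBlock c 0 i.succ ↔ ∃ j ∈ o, InSameBlock p j i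

theorem IsChildAt.unique {c' : SetPartition (n + 1)} {o : Option (Fin n)}
    (h : IsChildAt c p o) (h' : IsChildAt c' p o) : c = c' := by
  refine ext_inSameBlock fun i j => ?_
  have hcomm {r : SetPartition (n + 1)} {a b} : InSameBlock r a b ↔ InSameBlock r b a :=
    ⟨InSameBlock.symm, InSameBlock.symm⟩
  refine Fin.cases ?_ (fun i => ?_) i <;> refine Fin.cases ?_ (fun j => ?_) j
  · simp [inSameBlock_refl]
  · rw [h.2.2, h'.2.2]
  · rw [hcomm, h.2.2, hcomm, h'.2.2]
  · rw [← h.1, ← h'.1]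

theorem exists_isChildAt (p : SetPartition n) {o : Option (Fin n)}
    (ho : ∀ j ∈ o, IsBlockMin p j) : ∃ c, IsChildAt c p o := by
  let rel : Fin (n + 1) → Fin (n + 1) → Prop := fun a b =>
    Fin.cases (Fin.cases True (fun i => ∃ j ∈ o, InSameBlock p j i) b)
      (fun i => Fin.cases (∃ j ∈ o, InSameBlock p j i) (fun i' => InSameBlock p i i') b) a
  have hequiv : Equivalence rel := by
    refine ⟨fun a => ?_, fun {a b} => ?_, fun {a b d} => ?_⟩
    · refine Fin.cases ?_ (fun i => ?_) a
      · trivial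
      · exact inSameBlock_refl p i
    · refine Fin.cases ?_ (fun i => ?_) a <;> refine Fin.cases ?_ (fun i' => ?_) b
      · exact id
      · exact id
      · exact id
      · exact InSameBlock.symm
    · refine Fin.cases ?_ (fun i => ?_) a <;> refine Fin.cases ?_ (fun i' => ?_) b <;>
        refine Fin.cases ?_ (fun i'' => ?_) d
      · exact fun _ h => h
      · exact fun _ h => h
      · exact fun _ _ => trivial
      · rintro ⟨j, hj, h⟩ h'
        exact ⟨j, hj, h.trans h'⟩
      · exact fun h _ => h
      · rintro ⟨j, hj, h⟩ ⟨j', hj', h'⟩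
        obtain rfl := Option.mem_unique hj hj'
        exact h.symm.trans h'
      · rintro h ⟨j, hj, h'⟩
        exact ⟨j, hj, h'.trans h.symm⟩
      · exact InSameBlock.trans
  obtain ⟨c, hc⟩ := exists_setPartition ⟨rel, hequiv⟩
  exact ⟨c, fun i j => (hc i.succ j.succ).symm, ho, fun i => hc 0 i.succ⟩

theorem IsChild.exists_isChildAt (h : IsChild c p) : ∃ o, IsChildAt c p o := by
  classical
  by_cases hex : ∃ i : Fin n, InSameBlock c 0 i.succ
  · obtain ⟨j, hj, hjmin⟩ : ∃ j : Fin n, InSameBlock c 0 j.succ ∧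
        ∀ i : Fin n, InSameBlock c 0 i.succ → j ≤ i := by
      obtain ⟨j, hj, hmin⟩ := (univ.filter fun i : Fin n => InSameBlock c 0 i.succ).exists_minimal
        (by simpa [Finset.filter_nonempty_iff] using hex)
      refine ⟨j, by simpa using hj, fun i hi => ?_⟩
      exact (le_total j i).elim id (hmin (by simpa using hi))
    refine ⟨some j, h, ?_, fun i => ?_⟩
    · simp only [Option.mem_some_iff, forall_eq']
      exact fun i hi => hjmin i (hj.trans ((h i j).mp hi).symm)
    · simp only [Option.mem_some_iff, exists_eq_left', h j i]
      exact ⟨fun hi => hj.symm.trans hi, fun hi => hj.trans hi⟩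
  · exact ⟨none, h, by simp, fun i => by simpa using fun hi => hex ⟨i, hi⟩⟩

theorem exists_isChild (c : SetPartition (n + 1)) : ∃ p : SetPartition n, IsChild c p := by
  obtain ⟨p, hp⟩ := exists_setPartition (n := n)
    ⟨fun i j => InSameBlock c i.succ j.succ, fun i => inSameBlock_refl c _, InSameBlock.symm,
      InSameBlock.trans⟩
  exact ⟨p, hp⟩

theorem IsChild.parent_unique {p' : SetPartition n} (h : IsChild c p) (h' : IsChild c p') :
    p = p' :=
  ext_inSameBlock fun i j => (h i j).trans (h' i j).symm

variable {o : Option (Fin n)}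

theorem IsChildAt.isArc_zero (h : IsChildAt c p o) {j : Fin n} :
    IsArc c 0 j.succ ↔ j ∈ o := by
  rw [isArc_iff, h.2.2]
  constructor
  · rintro ⟨-, ⟨i, hi, hij⟩, hno⟩
    have hle := h.2.1 i hi j hij.symm
    have := hno i.succ ((h.2.2 i).mpr ⟨i, hi, inSameBlock_refl p i⟩)
    simp only [Fin.succ_pos, Fin.succ_lt_succ_iff, true_and, not_lt] at this
    rwa [← le_antisymm hle this]
  · intro hj
    refine ⟨Fin.succ_pos j, ⟨j, hj, inSameBlock_refl p j⟩, fun x => ?_⟩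
    refine Fin.cases (fun _ => by simp) (fun x hx => ?_) x
    obtain ⟨i, hi, hix⟩ := (h.2.2 x).mp hx
    obtain rfl := Option.mem_unique hi hj
    have := h.2.1 i hi x hix.symm
    simpa using this

theorem not_isArc_zero (c : SetPartition (n + 1)) (i : Fin (n + 1)) : ¬ IsArc c i 0 :=
  fun h => absurd h.1 (Fin.not_lt_zero i)

theorem IsChildAt.isBlockMin_succ (h : IsChildAt c p o) {i : Fin n} :
    IsBlockMin c i.succ ↔ IsBlockMin p i ∧ i ∉ o := by
  constructor
  · intro hi
    have hp : IsBlockMin p i := fun j hj => by simpa using hi j.succ ((h.1 j i).mp hj)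
    refine ⟨hp, fun hio => ?_⟩
    have := hi 0 ((h.2.2 i).mpr ⟨i, hio, inSameBlock_refl p i⟩)
    simp at this
  · rintro ⟨hp, hio⟩ x
    refine Fin.cases (fun hx => ?_) (fun x hx => ?_) x
    · obtain ⟨j, hj, hji⟩ := (h.2.2 i).mp hx
      exact absurd (le_antisymm (h.2.1 j hj i hji.symm) (hp j hji) ▸ hj) hio
    · simpa using hp x ((h.1 x i).mpr hx)

theorem IsChildAt.blockMins (h : IsChildAt c p o) :
    blockMins c = 0 :: ((blockMins p).filter fun i => i ∉ o).map Fin.succ := by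
  classical
  have h0 : IsBlockMin c 0 := fun j _ => Fin.zero_le j
  rw [_root_.blockMins, List.finRange_succ, List.filter_cons_of_pos (by simpa using h0),
    List.filter_map, _root_.blockMins, List.filter_filter]
  congr 2
  refine List.filter_congr fun i _ => ?_
  simp [h.isBlockMin_succ, Bool.and_comm]

theorem uStat_zero (p : SetPartition n) : uStat p 0 = 0 := by
  simp [uStat]

theorem IsChildAt.uStat_succ (h : IsChildAt c p o) (i : Fin n) :
    uStat c i.succ = uStat p i + if ∃ j ∈ o, i < j then 1 else 0 := by
  classical
  have hset : {e : Fin (n + 1) × Fin (n + 1) |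
      IsArc c e.1 e.2 ∧ (e.1 : ℕ) < (i.succ : ℕ) ∧ (i.succ : ℕ) < (e.2 : ℕ)} =
      Prod.map Fin.succ Fin.succ ''
        {e : Fin n × Fin n | IsArc p e.1 e.2 ∧ (e.1 : ℕ) < i ∧ (i : ℕ) < (e.2 : ℕ)} ∪
      (fun j : Fin n => ((0 : Fin (n + 1)), j.succ)) '' {j | j ∈ o ∧ i < j} := by
    ext ⟨a, b⟩
    refine Fin.cases ?_ (fun b => ?_) b
    · simp [not_isArc_zero]
    · refine Fin.cases ?_ (fun a => ?_) a
      · simp [h.isArc_zero, Fin.succ_ne_zero]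
      · simp [h.1.isArc_succ, (Fin.succ_ne_zero _).symm]
  rw [uStat, hset, Set.ncard_union_eq, Set.ncard_image_of_injective, Set.ncard_image_of_injective]
  · rw [uStat]
    congr 1
    split_ifs with hex
    · obtain ⟨j, hj, hij⟩ := hex
      rw [Set.ncard_eq_one]
      refine ⟨j, Set.ext fun x => ⟨fun hx => Option.mem_unique hx.1 hj, ?_⟩⟩
      rintro rfl
      exact ⟨hj, hij⟩
    · rw [Set.ncard_eq_zero]
      exact Set.eq_empty_of_forall_notMem fun x hx => hex ⟨x, hx⟩
  · exact fun a b hab => by simpa using hab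
  · exact (Fin.succ_injective n).prodMap (Fin.succ_injective n)
  · rw [Set.disjoint_left]
    rintro _ ⟨e, -, rfl⟩ ⟨j, -, hj⟩
    exact Fin.succ_ne_zero e.1 (Prod.ext_iff.mp hj).1.symm

theorem IsChildAt.cr_eq (h : IsChildAt c p o) :
    cr c = cr p + o.elim 0 fun j => uStat p j := by
  have hset : {e : (Fin (n + 1) × Fin (n + 1)) × (Fin (n + 1) × Fin (n + 1)) |
      IsArc c e.1.1 e.1.2 ∧ IsArc c e.2.1 e.2.2 ∧ Crossing e.1 e.2} =
      Prod.map (Prod.map Fin.succ Fin.succ) (Prod.map Fin.succ Fin.succ) ''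
        {e : (Fin n × Fin n) × (Fin n × Fin n) |
          IsArc p e.1.1 e.1.2 ∧ IsArc p e.2.1 e.2.2 ∧ Crossing e.1 e.2} ∪
      (fun e : Fin n × (Fin n × Fin n) =>
        (((0 : Fin (n + 1)), e.1.succ), Prod.map Fin.succ Fin.succ e.2)) ''
        {e | e.1 ∈ o ∧ IsArc p e.2.1 e.2.2 ∧ (e.2.1 : ℕ) < e.1 ∧ (e.1 : ℕ) < e.2.2} := by
    ext ⟨⟨a, b⟩, ⟨a', b'⟩⟩
    refine Fin.cases ?_ (fun b => ?_) b
    · simp [not_isArc_zero]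
    refine Fin.cases ?_ (fun b' => ?_) b'
    · simp [not_isArc_zero]
    refine Fin.cases ?_ (fun a' => ?_) a'
    · simp [Crossing, Fin.succ_ne_zero]
    refine Fin.cases ?_ (fun a => ?_) a
    · simp [h.isArc_zero, h.1.isArc_succ, Fin.succ_ne_zero, Crossing]
    · simp [h.1.isArc_succ, (Fin.succ_ne_zero _).symm, Crossing]
  have hsucc := (Fin.succ_injective n).prodMap (Fin.succ_injective n)
  rw [cr, hset, Set.ncard_union_eq, Set.ncard_image_of_injective, Set.ncard_image_of_injective]
  · rw [cr]
    congr 1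
    cases o with
    | none => simp
    | some j =>
      have : {e : Fin n × (Fin n × Fin n) | e.1 ∈ some j ∧ IsArc p e.2.1 e.2.2 ∧
          (e.2.1 : ℕ) < e.1 ∧ (e.1 : ℕ) < e.2.2} = Prod.mk j ''
          {e : Fin n × Fin n | IsArc p e.1 e.2 ∧ (e.1 : ℕ) < j ∧ (j : ℕ) < (e.2 : ℕ)} := by
        ext ⟨i, e⟩
        simp only [Option.mem_some_iff, Set.mem_ofPred_eq, Set.mem_image, Prod.mk.injEq]
        constructor
        · rintro ⟨rfl, he⟩
          exact ⟨e, he, rfl, rfl⟩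
        · rintro ⟨e, he, rfl, rfl⟩
          exact ⟨rfl, he⟩
      rw [this, Set.ncard_image_of_injective _ (Prod.mk_right_injective j)]
      rfl
  · exact fun a b hab => by
      simp only [Prod.mk.injEq, Fin.succ_inj, true_and] at hab
      exact Prod.ext hab.1 (hsucc hab.2)
  · exact hsucc.prodMap hsucc
  · rw [Set.disjoint_left]
    rintro _ ⟨e, -, rfl⟩ ⟨j, -, hj⟩
    exact Fin.succ_ne_zero e.1.1 (Prod.ext_iff.mp (Prod.ext_iff.mp hj).1).1.symm

/-- The state of a child, in terms of the parent. -/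
noncomputable def childState (p : SetPartition n) (o : Option (Fin n)) : ℕ × List ℕ :=
  (cr p + o.elim 0 fun j => uStat p j,
    0 :: ((blockMins p).filter fun i => i ∉ o).map fun i : Fin n =>
      uStat p i + if ∃ j ∈ o, i < j then 1 else 0)

theorem IsChildAt.crState_eq (h : IsChildAt c p o) : crState c = childState p o := by
  rw [crState, childState, h.cr_eq, h.blockMins]
  simp only [List.map_cons, List.map_map, Function.comp_def, h.uStat_succ, Fin.val_zero,
    uStat_zero]

theorem raisedErasures_map {α : Type*} [LinearOrder α] {L : List α} (hL : L.Pairwise (· < ·))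
    (u : α → ℕ) :
    raisedErasures (L.map u) = L.map fun j =>
      (u j, (L.filter fun i => i ≠ j).map fun i => u i + if i < j then 1 else 0) := by
  induction L with
  | nil => rfl
  | cons a L ih =>
    obtain ⟨ha, hL⟩ := List.pairwise_cons.mp hL
    rw [List.map_cons, raisedErasures, ih hL, List.map_cons, List.map_map]
    congr 1
    · have : L.filter (fun i => decide (i ≠ a)) = L :=
        List.filter_eq_self.mpr fun i hi => by simpa using (ha i hi).ne'
      rw [List.filter_cons_of_neg (by simp), this]
      exact congrArg _ (List.map_congr_left fun i hi => by simp [(ha i hi).not_gt])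
    · refine List.map_congr_left fun j hj => ?_
      rw [List.filter_cons_of_pos (by simpa using (ha j hj).ne)]
      simp [ha j hj]

theorem childStates_crState (p : SetPartition n) :
    childStates (crState p) = (none :: (blockMins p).map some).map (childState p) := by
  rw [childStates, crState, raisedErasures_map (blockMins_pairwise p), List.map_cons]
  congr 1
  · simp [childState]
  · simp only [List.map_map]
    refine List.map_congr_left fun j _ => ?_
    simp [childState, eq_comm]

/-- The places at which a child of `p` can be formed. -/
noncomputable def childPlaces (p : SetPartition n) : Finset (Option (Fin n)) :=
  insertNone (blockMins p).toFinset

theorem mem_childPlaces : o ∈ childPlaces p ↔ ∀ j ∈ o, IsBlockMin p j := by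
  simp [childPlaces, mem_blockMins]

theorem childPlaces_val (p : SetPartition n) :
    (childPlaces p).val = ((none :: (blockMins p).map some : List _) : Multiset _) := by
  refine (Multiset.Nodup.ext (childPlaces p).nodup ?_).mpr fun o => ?_
  · simpa using (blockMins_nodup p).map (Option.some_injective _)
  · cases o <;> simp [childPlaces]

theorem IsChildAt.place_unique {o' : Option (Fin n)} (h : IsChildAt c p o)
    (h' : IsChildAt c p o') : o = o' :=
  Option.ext fun _ => by
    rw [← Option.mem_def, ← Option.mem_def, ← h.isArc_zero, h'.isArc_zero]

open Classical in
/-- The children of a partition. -/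
noncomputable def children (p : SetPartition n) : Finset (SetPartition (n + 1)) :=
  univ.filter fun c => IsChild c p

theorem mem_children : c ∈ children p ↔ IsChild c p := by
  simp [children]

theorem map_crState_children (p : SetPartition n) :
    (children p).val.map crState = childStates (crState p) := by
  have hplace (c) (hc : c ∈ (children p).val) : ∃ o, IsChildAt c p o :=
    (mem_children.mp (mem_val.mp hc)).exists_isChildAt
  choose place hplace using hplace
  rw [childStates_crState, ← Multiset.map_coe, ← childPlaces_val]
  refine Multiset.map_eq_map_of_bij_of_nodup _ _ (children p).nodup (childPlaces p).nodup
    place ?_ ?_ ?_ ?_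
  · exact fun c hc => mem_childPlaces.mpr (hplace c hc).2.1
  · exact fun c hc c' hc' h => (hplace c hc).unique (h ▸ hplace c' hc')
  · intro o ho
    obtain ⟨c, hc⟩ := exists_isChildAt p (mem_childPlaces.mp ho)
    have hmem := mem_val.mpr (mem_children.mpr hc.1)
    exact ⟨c, hmem, (hplace c hmem).place_unique hc⟩
  · exact fun c hc => (hplace c hc).crState_eq

end Child

section Level

variable {n : ℕ}

open Classical in
/-- `level p l` as a finset. -/
noncomputable def levelFinset (p : SetPartition n) (l : ℕ) : Finset (SetPartition (n + l)) :=
  univ.filter fun t => t ∈ level p l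

theorem mem_levelFinset {p : SetPartition n} {l : ℕ} {t : SetPartition (n + l)} :
    t ∈ levelFinset p l ↔ t ∈ level p l := by
  simp [levelFinset]

theorem map_crState_levelFinset (p : SetPartition n) (l : ℕ) :
    (levelFinset p l).val.map crState = levelStates (crState p) l := by
  induction l with
  | zero =>
    have : levelFinset p 0 = {p} := by
      ext t
      rw [mem_levelFinset, Finset.mem_singleton]
      rfl
    rw [this]
    rfl
  | succ l ih =>
    classical
    have hval : (levelFinset p (l + 1)).val =
        (levelFinset p l).val.bind fun q => (children q).val := by
      have hdisj : (↑(levelFinset p l) : Set (SetPartition (n + l))).PairwiseDisjoint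
          children := by
        intro q _ q' _ hne
        rw [Function.onFun, disjoint_left]
        intro c hc hc'
        exact hne ((mem_children.mp hc).parent_unique (mem_children.mp hc'))
      rw [← disjiUnion_val (levelFinset p l) children hdisj]
      congr 1
      ext c
      rw [mem_levelFinset, mem_disjiUnion]
      simp only [mem_levelFinset, mem_children]
      rfl
    rw [hval, Multiset.map_bind, levelStates, ← ih, Multiset.bind_map]
    simp_rw [map_crState_children]

theorem ncard_level_eq (p : SetPartition n) (l m c : ℕ) :
    {t ∈ level p l | t.parts.card = m ∧ cr t = c}.ncard =
      (levelDistribution (crState p) l).count (c, m) := by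
  classical
  rw [levelDistribution, ← map_crState_levelFinset, Multiset.map_map, Multiset.count_map,
    ← Finset.filter_val, card_val, ← Set.ncard_coe_finset]
  congr 1
  ext t
  simp only [Set.mem_ofPred_eq, coe_filter, mem_levelFinset, Function.comp_apply, Prod.mk.injEq,
    crState]
  rw [and_comm (a := c = _), eq_comm (a := m), eq_comm (a := c)]
  have := length_crState t
  simp only [crState] at this
  rw [this]

theorem simCr_iff {p q : SetPartition n} (h : p.parts.card = q.parts.card) :
    SimCr p q ↔ cr p = cr q ∧ ((crState p).2 : Multiset ℕ) = (crState q).2 := by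
  rw [Multiset.coe_eq_coe]
  refine Iff.trans ?_ (levelDistribution_eq_iff (s := crState p) (t := crState q)
    (by rw [length_crState, length_crState, h]))
  simp only [SimCr, ncard_level_eq]
  exact forall_congr' fun l => ⟨fun H => Multiset.ext.mpr fun ⟨c, m⟩ => H m c,
    fun H m c => by rw [H]⟩

theorem reachable_iff {s : ℕ × List ℕ} : Reachable n s ↔ ∃ p : SetPartition n, crState p = s := by
  induction n generalizing s with
  | zero =>
    have h (p : SetPartition 0) : crState p = (0, []) := by
      simp [crState, cr, blockMins, Set.eq_empty_of_isEmpty]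
    simp only [Reachable, h, eq_comm (a := s), exists_const]
  | succ n ih =>
    simp only [Reachable, ih]
    constructor
    · rintro ⟨_, ⟨p, rfl⟩, hs⟩
      rw [← Multiset.mem_coe, ← map_crState_children, Multiset.mem_map] at hs
      obtain ⟨c, -, hc⟩ := hs
      exact ⟨c, hc⟩
    · rintro ⟨c, rfl⟩
      obtain ⟨p, hp⟩ := exists_isChild c
      refine ⟨_, ⟨p, rfl⟩, ?_⟩
      rw [← Multiset.mem_coe, ← map_crState_children]
      exact Multiset.mem_map_of_mem _ (mem_children.mpr hp)

theorem card_quotient_crSetoid {k : ℕ} (hk : 1 ≤ k) (hkn : k ≤ n) :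
    Nat.card (Quotient (crSetoid n k)) = (crPairs (n - k) k).card := by
  let f : {p : SetPartition n // p.parts.card = k} → ℕ × Multiset ℕ :=
    fun p => (cr p.1, ((crState p.1).2 : Multiset ℕ))
  have hker : crSetoid n k = Setoid.ker f := by
    ext p q
    rw [Setoid.ker_def, Prod.ext_iff]
    exact simCr_iff (p.2.trans q.2.symm)
  have hrange : Set.range f = crPairs (n - k) k := by
    ext ⟨c, M⟩
    rw [mem_coe, mem_crPairs hk, Nat.sub_add_cancel hkn]
    simp only [reachable_iff]
    constructor
    · rintro ⟨⟨p, hp⟩, h⟩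
      rw [Prod.mk.injEq] at h
      exact ⟨_, ⟨p, Prod.ext h.1 rfl⟩, h.2, (length_crState p).trans hp⟩
    · rintro ⟨L, ⟨p, hp⟩, rfl, hL⟩
      refine ⟨⟨p, by rw [← length_crState, hp, hL]⟩, ?_⟩
      rw [Prod.mk.injEq]
      exact ⟨congrArg Prod.fst hp, by rw [hp]⟩
  rw [hker, Nat.card_congr (Setoid.quotientKerEquivRange f), hrange, Nat.card_coe_set_eq,
    Set.ncard_coe_finset]

end Level

/-- Theorem 4.5, eq. (19). For `n ≥ k ≥ 1` and `m = min(n-k, k-1)`,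
the number of `∼_cr`-equivalence classes on `Π_{n,k}` is
`Σ_{l=0}^{m} C(k-1,l)·((n-k-1)l - l(l-1)/2 + 1)`. -/
theorem statement15 {n k : ℕ} (hk : 1 ≤ k) (hkn : k ≤ n) :
    Nat.card (Quotient (crSetoid n k)) =
      ∑ l ∈ Finset.range (min (n - k) (k - 1) + 1),
        (k - 1).choose l * ((n - k - 1) * l - l * (l - 1) / 2 + 1) := by
  rw [card_quotient_crSetoid hk hkn, card_crPairs hk]
end
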